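/- Let f : ℝⁿ → ℝ be real analytic and nonnegative, and suppose f⁻¹(0) is nonempty and has empty interior. Then the set {p ∈ f⁻¹(0) : there exists a nonconstant gradient flow γ : [0,∞) → ℝⁿ of f with lim_{t→∞} γ(t) = p} is dense in f⁻¹(0). -/

import Mathlib

open Filter

namespace GF
open Topology

section analytic
variable {V : Type*} [NormedAddCommGroup V] [NormedSpace ℝ V]

/-- A function analytic at `0` that vanishes on a small open set accumulating at `0` vanishes. -/
lemma eventually_zero_of_mul {f g : V → ℝ} (hf : AnalyticAt ℝ f 0) (hg : AnalyticAt ℝ g 0)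
    (h : ∀ᶠ x in 𝓝 (0 : V), f x * g x = 0) :
    (∀ᶠ x in 𝓝 (0 : V), f x = 0) ∨ (∀ᶠ x in 𝓝 (0 : V), g x = 0) := by
  by_contra hcon
  push Not at hcon
  obtain ⟨h1, h2⟩ := hcon
  have hev := (hf.eventually_analyticAt.and hg.eventually_analyticAt).and h
  obtain ⟨r, hr, hb⟩ := Metric.eventually_nhds_iff_ball.1 hev
  obtain ⟨z, hz, hzb⟩ := (h1.and_eventually (Metric.ball_mem_nhds 0 hr)).exists
  have hfz : ∀ᶠ x in 𝓝 z, f x ≠ 0 := (hb z hzb).1.1.continuousAt.eventually_ne hz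
  have hgz : g =ᶠ[𝓝 z] 0 := by
    filter_upwards [hfz, Metric.isOpen_ball.mem_nhds hzb] with x hx hxb
    exact (mul_eq_zero.1 (hb x hxb).2).resolve_left hx
  have : Set.EqOn g 0 (Metric.ball 0 r) :=
    AnalyticOnNhd.eqOn_zero_of_preconnected_of_eventuallyEq_zero
      (fun x hx => (hb x hx).1.2) (convex_ball 0 r).isPreconnected hzb hgz
  exact h2 (by filter_upwards [Metric.ball_mem_nhds (0:V) hr] with x hx using not_not.2 (this hx))

lemma analyticAt_average {G : V → ℝ} (hG : AnalyticAt ℝ G 0) {L : ℝ → V →L[ℝ] V}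
    (hL : Continuous L) : AnalyticAt ℝ (fun z => ∫ s in (0:ℝ)..1, G (L s z)) 0 := by
  obtain ⟨r, R, hr⟩ := hG
  obtain ⟨A₀, hA₀⟩ := (isCompact_Icc (a := (0:ℝ)) (b := 1)).exists_bound_of_continuousOn
    hL.continuousOn
  set A : ℝ := max A₀ 1 with hA
  have hA1 : 1 ≤ A := le_max_right _ _
  have hApos : 0 < A := by linarith
  have hLA : ∀ s ∈ Set.Icc (0:ℝ) 1, ‖L s‖ ≤ A := fun s hs => (hA₀ s hs).trans (le_max_left _ _)
  obtain ⟨ρ, hρ0, hρR⟩ := ENNReal.lt_iff_exists_nnreal_btwn.1 hr.r_pos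
  have hρ0' : 0 < ρ := by exact_mod_cast hρ0
  have hsum := r.summable_norm_mul_pow (hρR.trans_le hr.r_le)
  have hterm : ∀ (n : ℕ), Continuous fun s => (r n).compContinuousLinearMap (fun _ => L s) := by
    intro n
    have := (ContinuousMultilinearMap.compContinuousLinearMapContinuousMultilinear ℝ
      (fun _ : Fin n => V) (fun _ : Fin n => V) ℝ).cont
    have h2 : Continuous fun s : ℝ =>
      (ContinuousMultilinearMap.compContinuousLinearMapContinuousMultilinear ℝ
      (fun _ : Fin n => V) (fun _ : Fin n => V) ℝ) (fun _ => L s) :=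
      this.comp (continuous_pi fun _ => hL)
    exact h2.clm_apply continuous_const
  have hnorm : ∀ n, ∀ s ∈ Set.Icc (0:ℝ) 1,
      ‖(r n).compContinuousLinearMap (fun _ => L s)‖ ≤ ‖r n‖ * A ^ n := by
    intro n s hs
    refine (ContinuousMultilinearMap.norm_compContinuousLinearMap_le _ _).trans ?_
    gcongr
    rw [Finset.prod_const, Finset.card_univ, Fintype.card_fin]
    gcongr
    exact hLA s hs
  let Q : FormalMultilinearSeries ℝ V ℝ := fun n =>
    ∫ s in (0:ℝ)..1, (r n).compContinuousLinearMap (fun _ => L s)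
  have hQ : ∀ n, ‖Q n‖ ≤ ‖r n‖ * A ^ n := by
    intro n
    have := intervalIntegral.norm_integral_le_of_norm_le_const (a := (0:ℝ)) (b := 1)
      (f := fun s => (r n).compContinuousLinearMap (fun _ => L s)) (C := ‖r n‖ * A ^ n) (by
        intro s hs
        rw [Set.uIoc_of_le zero_le_one] at hs
        exact hnorm n s ⟨hs.1.le, hs.2⟩)
    simpa using this
  let A' : NNReal := ⟨A, hApos.le⟩
  have hA'pos : 0 < A' := hApos
  refine ⟨Q, ((ρ / A' : NNReal) : ENNReal), ?_, ?_, ?_⟩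
  · obtain ⟨C, hC⟩ := hsum.tendsto_atTop_zero.bddAbove_range
    refine Q.le_radius_of_bound C fun n => ?_
    refine le_trans ?_ (hC ⟨n, rfl⟩)
    have : ((ρ / A' : NNReal) : ℝ) ^ n = ρ ^ n / A ^ n := by
      rw [NNReal.coe_div, div_pow]; rfl
    rw [this]
    calc ‖Q n‖ * (ρ ^ n / A ^ n) ≤ (‖r n‖ * A ^ n) * (ρ ^ n / A ^ n) := by
          gcongr; exact hQ n
      _ = ‖r n‖ * ρ ^ n := by field_simp
  · exact_mod_cast div_pos hρ0' hA'pos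
  · intro y hy
    have hy' : ‖y‖ < ρ / A := by
      rw [Metric.eball_coe] at hy
      have h0 : ‖y‖ < ρ / A' := by simpa using hy
      exact h0
    have hyA : ∀ s ∈ Set.Icc (0:ℝ) 1, ‖L s y‖ < ρ := by
      intro s hs
      calc ‖L s y‖ ≤ ‖L s‖ * ‖y‖ := (L s).le_opNorm y
        _ ≤ A * ‖y‖ := by gcongr; exact hLA s hs
        _ < A * (ρ / A) := by gcongr
        _ = ρ := by field_simp
    have hQy : ∀ n, Q n (fun _ => y) = ∫ s in (0:ℝ)..1, r n (fun _ => L s y) := by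
      intro n
      have := (ContinuousMultilinearMap.apply ℝ (fun _ : Fin n => V) ℝ
        (fun _ => y)).intervalIntegral_comp_comm
        ((hterm n).intervalIntegrable (μ := MeasureTheory.volume) (0:ℝ) 1)
      exact this.symm
    simp_rw [hQy, zero_add]
    refine intervalIntegral.hasSum_integral_of_dominated_convergence
      (fun n _ => ‖r n‖ * ρ ^ n) ?_ ?_ ?_ ?_ ?_
    · intro n
      refine Continuous.aestronglyMeasurable ?_
      exact (r n).cont.comp (continuous_pi fun _ => hL.clm_apply continuous_const)
    · intro n
      refine Eventually.of_forall fun s hs => ?_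
      rw [Set.uIoc_of_le zero_le_one] at hs
      refine ((r n).le_opNorm _).trans ?_
      gcongr
      rw [Finset.prod_const, Finset.card_univ, Fintype.card_fin]
      gcongr
      exact (hyA s ⟨hs.1.le, hs.2⟩).le
    · exact Eventually.of_forall fun s _ => hsum
    · exact intervalIntegrable_const
    · refine Eventually.of_forall fun s hs => ?_
      rw [Set.uIoc_of_le zero_le_one] at hs
      have hmem : L s y ∈ Metric.eball (0:V) R := by
        have h1 := hyA s ⟨hs.1.le, hs.2⟩
        have : L s y ∈ Metric.eball (0:V) ρ := by
          rw [Metric.eball_coe]; simpa using h1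
        exact Metric.eball_subset_eball hρR.le this
      simpa using hr.hasSum hmem

/-- Hadamard division. -/
lemma exists_division {g : V → ℝ} (hg : AnalyticAt ℝ g 0) (ℓ : V →L[ℝ] ℝ) (e : V) :
    ∃ q : V → ℝ, AnalyticAt ℝ q 0 ∧ ∀ᶠ z in 𝓝 (0 : V), g z = g (z - ℓ z • e) + ℓ z * q z := by
  let E : V →L[ℝ] V := ℓ.smulRight e
  let L : ℝ → V →L[ℝ] V := fun s => (ContinuousLinearMap.id ℝ V - E) + s • E
  have hL : Continuous L := by fun_prop
  have hG : AnalyticAt ℝ (fun z => fderiv ℝ g z e) 0 :=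
    ((ContinuousLinearMap.apply ℝ ℝ e).analyticAt _).comp hg.fderiv
  refine ⟨_, analyticAt_average hG hL, ?_⟩
  obtain ⟨A, hA⟩ := (isCompact_Icc (a := (0:ℝ)) (b := 1)).exists_bound_of_continuousOn
    hL.continuousOn
  obtain ⟨δ, hδ, hb⟩ := Metric.eventually_nhds_iff_ball.1 (hg.eventually_analyticAt)
  have hsmall : ∀ᶠ z in 𝓝 (0:V), (|A| + 1) * ‖z‖ < δ := by
    have : Tendsto (fun z : V => (|A| + 1) * ‖z‖) (𝓝 0) (𝓝 ((|A| + 1) * ‖(0:V)‖)) :=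
      (continuous_const.mul continuous_norm).tendsto 0
    rw [norm_zero, mul_zero] at this
    exact this.eventually_lt_const hδ
  filter_upwards [hsmall] with z hz
  have hin : ∀ s ∈ Set.Icc (0:ℝ) 1, L s z ∈ Metric.ball (0:V) δ := by
    intro s hs
    rw [mem_ball_zero_iff]
    calc ‖L s z‖ ≤ ‖L s‖ * ‖z‖ := (L s).le_opNorm z
      _ ≤ (|A| + 1) * ‖z‖ := by
        gcongr
        exact (hA s hs).trans ((le_abs_self A).trans (by linarith))
      _ < δ := hz
  have hd : ∀ s ∈ Set.uIcc (0:ℝ) 1, HasDerivAt (fun s => g (L s z)) (ℓ z * fderiv ℝ g (L s z) e) s := by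
    intro s hs
    rw [Set.uIcc_of_le zero_le_one] at hs
    have h1 : HasDerivAt (fun s => L s z) (ℓ z • e) s := by
      have : HasDerivAt (fun s : ℝ => (z - E z) + s • E z) ((1:ℝ) • E z) s :=
        ((hasDerivAt_id s).smul_const (E z)).const_add _
      simpa [L, E] using this
    have h2 := (hb _ (hin s hs)).differentiableAt.hasFDerivAt.comp_hasDerivAt s h1
    rw [map_smul, smul_eq_mul] at h2
    exact h2
  have hcont : ContinuousOn (fun s => ℓ z * fderiv ℝ g (L s z) e) (Set.uIcc (0:ℝ) 1) := by
    intro s hs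
    rw [Set.uIcc_of_le zero_le_one] at hs
    have h1 : ContinuousAt (fun z => fderiv ℝ g z e) (L s z) :=
      (((ContinuousLinearMap.apply ℝ ℝ e).analyticAt _).comp (hb _ (hin s hs)).fderiv).continuousAt
    have h2 : ContinuousAt (fun s => L s z) s := (hL.clm_apply continuous_const).continuousAt
    exact (continuousAt_const.mul (ContinuousAt.comp (f := fun s => L s z) h1 h2)).continuousWithinAt
  have := intervalIntegral.integral_eq_sub_of_hasDerivAt hd hcont.intervalIntegrable
  rw [intervalIntegral.integral_const_mul] at this
  rw [this]
  simp [L, E]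

end analytic
end GF

namespace GF
open Topology

section MU
variable {κ : Type*} [Fintype κ]

/-- The monomial with exponent `α`. -/
def mon (α : κ → ℕ) (x : κ → ℝ) : ℝ := ∏ i, x i ^ α i

lemma mon_add (α β : κ → ℕ) (x : κ → ℝ) : mon (α + β) x = mon α x * mon β x := by
  simp [mon, pow_add, Finset.prod_mul_distrib]

lemma mon_zero (x : κ → ℝ) : mon 0 x = 1 := by simp [mon]

lemma mon_nsmul (k : ℕ) (α : κ → ℕ) (x : κ → ℝ) : mon (k • α) x = mon α x ^ k := by
  simp [mon, Finset.prod_pow, mul_comm k, pow_mul]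

lemma mon_single [DecidableEq κ] (k : κ) (x : κ → ℝ) : mon (Pi.single k 1) x = x k := by
  rw [mon, Finset.prod_eq_single k]
  · simp
  · intro b _ hb; simp [hb]
  · simp

lemma analyticAt_coord (i : κ) (a : κ → ℝ) : AnalyticAt ℝ (fun x : κ → ℝ => x i) a :=
  (ContinuousLinearMap.proj (R := ℝ) (φ := fun _ : κ => ℝ) i).analyticAt a

lemma analyticAt_mon (α : κ → ℕ) (a : κ → ℝ) : AnalyticAt ℝ (mon α) a :=
  Finset.analyticAt_fun_prod _ fun i _ => (analyticAt_coord i a).fun_pow _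

lemma mon_apply_zero {α : κ → ℕ} (h : α ≠ 0) : mon α 0 = 0 := by
  obtain ⟨k, hk⟩ := Function.ne_iff.1 h
  exact Finset.prod_eq_zero (Finset.mem_univ k) (by simpa using hk)

/-- `g` is near `0` the monomial with exponent `α` times a unit. -/
def MUe (α : κ → ℕ) (g : (κ → ℝ) → ℝ) : Prop :=
  ∃ u : (κ → ℝ) → ℝ, AnalyticAt ℝ u 0 ∧ u 0 ≠ 0 ∧ ∀ᶠ x in 𝓝 0, g x = mon α x * u x

/-- `g` is near `0` a monomial times a unit. -/
def MU (g : (κ → ℝ) → ℝ) : Prop := ∃ α, MUe α g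

lemma MUe.congr {α : κ → ℕ} {f g : (κ → ℝ) → ℝ} (hf : MUe α f) (h : ∀ᶠ x in 𝓝 0, g x = f x) :
    MUe α g := by
  obtain ⟨u, hu, hu0, hfu⟩ := hf
  refine ⟨u, hu, hu0, ?_⟩
  filter_upwards [h, hfu] with x h1 h2 using h1.trans h2

lemma MU.congr {f g : (κ → ℝ) → ℝ} (hf : MU f) (h : ∀ᶠ x in 𝓝 0, g x = f x) : MU g :=
  hf.imp fun _ h' => h'.congr h

lemma MUe.mul {α β : κ → ℕ} {f g : (κ → ℝ) → ℝ} (hf : MUe α f) (hg : MUe β g) :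
    MUe (α + β) (fun x => f x * g x) := by
  obtain ⟨u, hu, hu0, hfu⟩ := hf
  obtain ⟨v, hv, hv0, hgv⟩ := hg
  refine ⟨fun x => u x * v x, hu.mul hv, mul_ne_zero hu0 hv0, ?_⟩
  filter_upwards [hfu, hgv] with x h1 h2
  rw [h1, h2, mon_add]; ring

lemma MUe.of_unit {u : (κ → ℝ) → ℝ} (hu : AnalyticAt ℝ u 0) (hu0 : u 0 ≠ 0) : MUe 0 u :=
  ⟨u, hu, hu0, by simp [mon_zero]⟩

lemma MUe.pow {α : κ → ℕ} {f : (κ → ℝ) → ℝ} (hf : MUe α f) (k : ℕ) :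
    MUe (k • α) (fun x => f x ^ k) := by
  obtain ⟨u, hu, hu0, hfu⟩ := hf
  refine ⟨fun x => u x ^ k, hu.fun_pow k, pow_ne_zero _ hu0, ?_⟩
  filter_upwards [hfu] with x h1
  rw [h1, mon_nsmul, mul_pow]

lemma MU.mul {f g : (κ → ℝ) → ℝ} (hf : MU f) (hg : MU g) : MU (fun x => f x * g x) :=
  let ⟨_, h1⟩ := hf; let ⟨_, h2⟩ := hg; ⟨_, h1.mul h2⟩

lemma MU.pow {f : (κ → ℝ) → ℝ} (hf : MU f) (k : ℕ) : MU (fun x => f x ^ k) :=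
  let ⟨_, h1⟩ := hf; ⟨_, h1.pow k⟩

lemma MU.of_unit {u : (κ → ℝ) → ℝ} (hu : AnalyticAt ℝ u 0) (hu0 : u 0 ≠ 0) : MU u :=
  ⟨0, MUe.of_unit hu hu0⟩

lemma MUe.of_mon (α : κ → ℕ) : MUe α (mon α) :=
  ⟨fun _ => 1, analyticAt_const, one_ne_zero, by simp⟩

lemma MUe.coord [DecidableEq κ] (k : κ) : MUe (Pi.single k 1) (fun x : κ → ℝ => x k) :=
  (MUe.of_mon _).congr (by simp [mon_single])

lemma MU.coord (k : κ) : MU (fun x : κ → ℝ => x k) := by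
  classical exact ⟨_, MUe.coord k⟩

lemma MU.prod {σ : Type*} (s : Finset σ) {f : σ → (κ → ℝ) → ℝ} (h : ∀ j ∈ s, MU (f j)) :
    MU (fun x => ∏ j ∈ s, f j x) := by
  classical
  induction s using Finset.induction_on with
  | empty => simpa using MU.of_unit (u := fun _ => 1) analyticAt_const one_ne_zero
  | insert a s ha ih =>
    simp only [Finset.prod_insert ha]
    exact (h a (by simp)).mul (ih fun j hj => h j (by simp [hj]))

lemma MU.mon_comp {κ' : Type*} [Fintype κ'] {p : (κ' → ℝ) → κ → ℝ} (hp : ∀ i, MU (fun z => p z i))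
    (α : κ → ℕ) : MU (fun z => mon α (p z)) :=
  MU.prod _ fun i _ => (hp i).pow _

lemma MU.comp {κ' : Type*} [Fintype κ'] {p : (κ' → ℝ) → κ → ℝ} (hpa : AnalyticAt ℝ p 0)
    (hp0 : p 0 = 0) (hp : ∀ i, MU (fun z => p z i)) {g : (κ → ℝ) → ℝ} (hg : MU g) :
    MU (fun z => g (p z)) := by
  obtain ⟨α, u, hu, hu0, hgu⟩ := hg
  have h1 : MU (fun z => u (p z)) := by
    refine MU.of_unit (AnalyticAt.fun_comp (by rwa [hp0]) hpa) (by rwa [hp0])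
  refine ((MU.mon_comp hp α).mul h1).congr ?_
  have : Tendsto p (𝓝 0) (𝓝 0) := by simpa [hp0] using hpa.continuousAt.tendsto
  exact this.eventually hgu

lemma not_eventually_coord (k : κ) : ¬ ∀ᶠ x in 𝓝 (0 : κ → ℝ), x k = 0 := by
  classical
  intro h
  have hc : Tendsto (fun t : ℝ => (Pi.single k t : κ → ℝ)) (𝓝 0) (𝓝 0) := by
    have : Continuous (fun t : ℝ => (Pi.single k t : κ → ℝ)) := by
      refine continuous_pi fun i => ?_
      by_cases hik : i = k
      · subst hik; simpa using continuous_id'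
      · simpa [hik] using continuous_const
    simpa using this.tendsto 0
  have h2 := hc.eventually h
  simp only [Pi.single_eq_same] at h2
  have h3 : ∀ᶠ t in 𝓝[≠] (0:ℝ), t = 0 := h2.filter_mono nhdsWithin_le_nhds
  obtain ⟨t, ht, ht'⟩ := (h3.and self_mem_nhdsWithin).exists
  exact ht' ht

lemma MU.not_eventually_zero {f : (κ → ℝ) → ℝ} (hf : MU f) : ¬ ∀ᶠ x in 𝓝 0, f x = 0 := by
  obtain ⟨α, u, hu, hu0, hfu⟩ := hf
  intro h
  have h1 : ∀ᶠ x in 𝓝 (0 : κ → ℝ), mon α x = 0 := by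
    filter_upwards [h, hfu, hu.continuousAt.eventually_ne hu0] with x a b c
    rw [a] at b
    exact (mul_eq_zero.1 b.symm).resolve_right c
  have key : ∀ s : Finset κ, ¬ ∀ᶠ x in 𝓝 (0 : κ → ℝ), ∏ i ∈ s, x i ^ α i = 0 := by
    classical
    intro s
    induction s using Finset.induction_on with
    | empty => simpa using (NeBot.ne (f := 𝓝 (0 : κ → ℝ)) inferInstance)
    | insert a s ha ih =>
      intro hh
      simp only [Finset.prod_insert ha] at hh
      rcases eventually_zero_of_mul ((analyticAt_coord a 0).fun_pow _)
        (Finset.analyticAt_fun_prod _ fun i _ => (analyticAt_coord i 0).fun_pow _) hh with h' | h'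
      · exact not_eventually_coord a (h'.mono fun x hx => eq_zero_of_pow_eq_zero hx)
      · exact ih h'
  exact key _ h1

lemma MU.of_mul {f g : (κ → ℝ) → ℝ} (hf : AnalyticAt ℝ f 0) (hg : AnalyticAt ℝ g 0)
    (h : MU (fun x => f x * g x)) : MU f := by
  classical
  obtain ⟨α, u, hu, hu0, hfu⟩ := h
  obtain ⟨N, hN⟩ : ∃ N, ∑ i, α i = N := ⟨_, rfl⟩
  induction N generalizing f g α with
  | zero =>
    have hα : α = 0 := by
      ext i
      exact (Finset.sum_eq_zero_iff.1 hN) i (Finset.mem_univ i)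
    subst hα
    have h0 := hfu.self_of_nhds
    rw [mon_zero, one_mul] at h0
    replace h0 : f 0 * g 0 = u 0 := h0
    exact MU.of_unit hf (fun h' => hu0 (by rw [← h0, h', zero_mul]))
  | succ N ih =>
    obtain ⟨k, hk⟩ : ∃ k, α k ≠ 0 := by
      by_contra hcon
      push Not at hcon
      simp [hcon] at hN
    let α' : κ → ℕ := fun i => α i - (Pi.single k 1 : κ → ℕ) i
    have hα' : α = α' + Pi.single k 1 := by
      ext i
      by_cases hik : i = k
      · subst hik; simp [α']; omega
      · simp [α', hik]
    have hsum' : ∑ i, α' i = N := by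
      rw [hα'] at hN
      simp [Finset.sum_add_distrib] at hN
      omega
    let ℓ : (κ → ℝ) →L[ℝ] ℝ := ContinuousLinearMap.proj k
    let e : κ → ℝ := Pi.single k 1
    let P : (κ → ℝ) →L[ℝ] (κ → ℝ) := ContinuousLinearMap.id ℝ _ - ℓ.smulRight e
    have hP : ∀ z, P z = z - ℓ z • e := fun z => rfl
    have hPk : ∀ z, P z k = 0 := by intro z; simp [hP, ℓ, e]
    have hPt : Tendsto P (𝓝 0) (𝓝 0) := by simpa using P.continuous.tendsto 0
    have hprod : ∀ᶠ z in 𝓝 0, f (P z) * g (P z) = 0 := by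
      filter_upwards [hPt.eventually hfu] with z hz
      rw [hz, hα', mon_add, mon_single, hPk]; simp
    have hfP : AnalyticAt ℝ (fun z => f (P z)) 0 :=
      AnalyticAt.fun_comp (by simpa using hf) (P.analyticAt 0)
    have hgP : AnalyticAt ℝ (fun z => g (P z)) 0 :=
      AnalyticAt.fun_comp (by simpa using hg) (P.analyticAt 0)
    -- cancellation
    have cancel : ∀ f' g' : (κ → ℝ) → ℝ, AnalyticAt ℝ f' 0 → AnalyticAt ℝ g' 0 →
        (∀ᶠ z in 𝓝 0, f z * g z = z k * (f' z * g' z)) →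
        ∀ᶠ z in 𝓝 0, f' z * g' z = mon α' z * u z := by
      intro f' g' hf' hg' hh
      have : ∀ᶠ z in 𝓝 (0 : κ → ℝ), z k * (f' z * g' z - mon α' z * u z) = 0 := by
        filter_upwards [hh, hfu] with z h1 h2
        rw [h1, hα', mon_add, mon_single] at h2
        linear_combination h2
      rcases eventually_zero_of_mul (analyticAt_coord k 0)
        ((hf'.mul hg').sub ((analyticAt_mon α' 0).mul hu)) this with h' | h'
      · exact absurd h' (not_eventually_coord k)
      · filter_upwards [h'] with z hz
        exact sub_eq_zero.1 hz
    rcases eventually_zero_of_mul hfP hgP hprod with h' | h'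
    · obtain ⟨q, hq, hqe⟩ := exists_division hf ℓ e
      have hfq : ∀ᶠ z in 𝓝 0, f z = z k * q z := by
        filter_upwards [hqe, h'] with z h1 h2
        rw [h1, ← hP, h2, zero_add]; rfl
      have := cancel q g hq hg (by
        filter_upwards [hfq] with z hz; rw [hz]; ring)
      exact ((MU.coord k).mul (ih hq hg α' this hsum')).congr hfq
    · obtain ⟨q, hq, hqe⟩ := exists_division hg ℓ e
      have hfq : ∀ᶠ z in 𝓝 0, g z = z k * q z := by
        filter_upwards [hqe, h'] with z h1 h2
        rw [h1, ← hP, h2, zero_add]; rfl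
      have := cancel f q hf hq (by
        filter_upwards [hfq] with z hz; rw [hz]; ring)
      exact ih hf hq α' this hsum'

lemma MU.of_prod {σ : Type*} (s : Finset σ) {f : σ → (κ → ℝ) → ℝ}
    (hf : ∀ j ∈ s, AnalyticAt ℝ (f j) 0) (h : MU (fun x => ∏ j ∈ s, f j x)) :
    ∀ j ∈ s, MU (f j) := by
  classical
  intro j hj
  refine MU.of_mul (g := fun x => ∏ i ∈ s.erase j, f i x) (hf j hj)
    (Finset.analyticAt_fun_prod _ fun i hi => hf i (Finset.mem_of_mem_erase hi)) ?_
  refine h.congr (Eventually.of_forall fun x => ?_)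
  exact Finset.mul_prod_erase s (fun i => f i x) hj

lemma pow_compare {a b : ℕ} {A B : ℝ → ℝ} {A0 B0 : ℝ} (hA0 : A0 ≠ 0)
    (hA : Tendsto A (𝓝[>] 0) (𝓝 A0)) (hB : Tendsto B (𝓝[>] 0) (𝓝 B0))
    (h : ∀ᶠ t in 𝓝[>] (0:ℝ), t ^ a * A t = t ^ b * B t) : b ≤ a := by
  by_contra hlt
  push Not at hlt
  have h1 : ∀ᶠ t in 𝓝[>] (0:ℝ), A t = t ^ (b - a) * B t := by
    filter_upwards [h, self_mem_nhdsWithin] with t ht ht0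
    have ht0' : t ^ a ≠ 0 := pow_ne_zero _ (ne_of_gt ht0)
    have : b = a + (b - a) := by omega
    rw [this, pow_add, mul_assoc] at ht
    exact mul_left_cancel₀ ht0' ht
  have h2 : Tendsto (fun t : ℝ => t ^ (b - a) * B t) (𝓝[>] 0) (𝓝 (0 ^ (b - a) * B0)) :=
    (((continuous_pow _).tendsto 0).mono_left nhdsWithin_le_nhds).mul hB
  rw [zero_pow (by omega), zero_mul] at h2
  exact hA0 (tendsto_nhds_unique (hA.congr' h1) h2)

lemma MUe.comparable {α β γ : κ → ℕ} {f g : (κ → ℝ) → ℝ} (hf : MUe α f) (hg : MUe β g)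
    (hfg : MUe γ (fun x => f x - g x)) : α ≤ β ∨ β ≤ α := by
  classical
  by_contra hcon
  push Not at hcon
  obtain ⟨h1, h2⟩ := hcon
  obtain ⟨u, hu, hu0, hfu⟩ := hf
  obtain ⟨v, hv, hv0, hgv⟩ := hg
  obtain ⟨w, hw, hw0, hfgw⟩ := hfg
  -- evaluation along weighted curves
  have curve : ∀ ω : κ → ℕ, (∀ i, 0 < ω i) →
      (∑ i, ω i * α i < ∑ i, ω i * β i → ∑ i, ω i * γ i = ∑ i, ω i * α i) ∧
      (∑ i, ω i * β i < ∑ i, ω i * α i → ∑ i, ω i * γ i = ∑ i, ω i * β i) ∧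
      min (∑ i, ω i * α i) (∑ i, ω i * β i) ≤ ∑ i, ω i * γ i := by
    intro ω hω
    let c : ℝ → κ → ℝ := fun t i => t ^ ω i
    have hc : Tendsto c (𝓝[>] 0) (𝓝 0) := by
      have : Continuous c := continuous_pi fun i => continuous_pow _
      have h0 : c 0 = 0 := by
        ext i; simp [c, (hω i).ne']
      simpa [h0] using (this.tendsto 0).mono_left nhdsWithin_le_nhds
    have hmon : ∀ (δ : κ → ℕ) t, mon δ (c t) = t ^ (∑ i, ω i * δ i) := by
      intro δ t
      simp [mon, c, ← pow_mul, Finset.prod_pow_eq_pow_sum]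
    have hU : Tendsto (fun t => u (c t)) (𝓝[>] 0) (𝓝 (u 0)) := hu.continuousAt.tendsto.comp hc
    have hV : Tendsto (fun t => v (c t)) (𝓝[>] 0) (𝓝 (v 0)) := hv.continuousAt.tendsto.comp hc
    have hW : Tendsto (fun t => w (c t)) (𝓝[>] 0) (𝓝 (w 0)) := hw.continuousAt.tendsto.comp hc
    have hE : ∀ᶠ t in 𝓝[>] (0:ℝ), t ^ (∑ i, ω i * α i) * u (c t) - t ^ (∑ i, ω i * β i) * v (c t)
        = t ^ (∑ i, ω i * γ i) * w (c t) := by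
      filter_upwards [hc.eventually hfu, hc.eventually hgv, hc.eventually hfgw] with t a b d
      rw [a, b] at d
      simpa [hmon] using d
    generalize (∑ i, ω i * α i) = a at *
    generalize (∑ i, ω i * β i) = b at *
    generalize (∑ i, ω i * γ i) = d at *
    have hpow : ∀ k : ℕ, Tendsto (fun t : ℝ => t ^ k) (𝓝[>] 0) (𝓝 (0 ^ k)) := fun k =>
      ((continuous_pow _).tendsto 0).mono_left nhdsWithin_le_nhds
    have hmin : min a b ≤ d := by
      refine pow_compare (A := fun t => w (c t))
        (B := fun t => t ^ (a - min a b) * u (c t) - t ^ (b - min a b) * v (c t)) hw0 hW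
        (((hpow _).mul hU).sub ((hpow _).mul hV)) ?_
      filter_upwards [hE] with t ht
      rw [← ht, mul_sub, ← mul_assoc, ← mul_assoc, ← pow_add, ← pow_add,
        Nat.add_sub_cancel' (min_le_left a b), Nat.add_sub_cancel' (min_le_right a b)]
    refine ⟨fun hab => ?_, fun hab => ?_, hmin⟩
    · refine le_antisymm ?_ (by rwa [min_eq_left hab.le] at hmin)
      have hlim := hU.sub ((hpow (b - a)).mul hV)
      rw [zero_pow (by omega), zero_mul, sub_zero] at hlim
      refine pow_compare hu0 hlim hW ?_
      filter_upwards [hE] with t ht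
      rw [← ht, mul_sub, ← mul_assoc, ← pow_add, Nat.add_sub_cancel' hab.le]
    · refine le_antisymm ?_ (by rwa [min_eq_right hab.le] at hmin)
      have hlim := ((hpow (a - b)).mul hU).sub hV
      rw [zero_pow (by omega), zero_mul, zero_sub] at hlim
      refine pow_compare (neg_ne_zero.2 hv0) hlim hW ?_
      filter_upwards [hE] with t ht
      rw [← ht, mul_sub, ← mul_assoc, ← pow_add, Nat.add_sub_cancel' hab.le]
  have weight : ∀ δ ε : κ → ℕ, ¬ δ ≤ ε → ∃ ω : κ → ℕ, (∀ i, 0 < ω i) ∧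
      ∑ i, ω i * ε i < ∑ i, ω i * δ i := by
    intro δ ε hδε
    rw [Pi.le_def] at hδε
    push Not at hδε
    obtain ⟨j, hj⟩ := hδε
    let M := ∑ i, ε i + 1
    have hexp : ∀ η : κ → ℕ, ∑ i, (1 + if i = j then M else 0) * η i = ∑ i, η i + M * η j := by
      intro η
      simp [add_mul, Finset.sum_add_distrib, ite_mul]
    refine ⟨fun i => 1 + if i = j then M else 0, fun i => by positivity, ?_⟩
    rw [hexp, hexp]
    have : M * ε j + M ≤ M * δ j := by
      calc M * ε j + M = M * (ε j + 1) := by ring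
        _ ≤ M * δ j := Nat.mul_le_mul_left _ hj
    have hM : ∑ i, ε i < M := Nat.lt_succ_self _
    omega
  obtain ⟨ω₁, hω₁, hlt₁⟩ := weight α β h1
  obtain ⟨ω₂, hω₂, hlt₂⟩ := weight β α h2
  have e1 := (curve ω₁ hω₁).2.1 hlt₁
  have e2 := (curve ω₂ hω₂).1 hlt₂
  have e3 := (curve (ω₁ + ω₂) (fun i => Nat.add_pos_left (hω₁ i) _)).2.2
  simp only [Pi.add_apply, add_mul, Finset.sum_add_distrib] at e3
  rw [min_le_iff] at e3
  omega

end MU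
end GF

namespace GF
open Topology

section lifts
variable {ι : Type*} {κ κ' κ'' : Type*} [Fintype κ] [Fintype κ'] [Fintype κ'']

/-- `Y` is a lift through the analytic germ `p` of the family `X` of points. -/
structure Lift (𝓕 : Ultrafilter ι) (X : ι → κ → ℝ) (p : (κ' → ℝ) → κ → ℝ) (Y : ι → κ' → ℝ) :
    Prop where
  an : AnalyticAt ℝ p 0
  zero : p 0 = 0
  tend : Tendsto Y 𝓕 (𝓝 0)
  eq : ∀ᶠ i in (𝓕 : Filter ι), p (Y i) = X i

variable {𝓕 : Ultrafilter ι}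

lemma Lift.comp {X : ι → κ → ℝ} {p : (κ' → ℝ) → κ → ℝ} {Y : ι → κ' → ℝ}
    {p' : (κ'' → ℝ) → κ' → ℝ} {Z : ι → κ'' → ℝ} (h : Lift 𝓕 X p Y) (h' : Lift 𝓕 Y p' Z) :
    Lift 𝓕 X (fun z => p (p' z)) Z where
  an := AnalyticAt.fun_comp (by rw [h'.zero]; exact h.an) h'.an
  zero := by rw [h'.zero, h.zero]
  tend := h'.tend
  eq := by
    filter_upwards [h.eq, h'.eq] with i h1 h2
    rw [h2, h1]

lemma Lift.tendsto {X : ι → κ → ℝ} {p : (κ' → ℝ) → κ → ℝ} {Y : ι → κ' → ℝ}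
    (h : Lift 𝓕 X p Y) : Tendsto p (𝓝 0) (𝓝 0) := by
  simpa [h.zero] using h.an.continuousAt.tendsto

lemma Lift.id {X : ι → κ → ℝ} (hX : Tendsto X 𝓕 (𝓝 0)) : Lift 𝓕 X (fun z => z) X :=
  ⟨analyticAt_id, rfl, hX, by simp⟩

lemma dichotomy (a b : ι → ℝ) :
    (∃ s : ι → ℝ, Tendsto s 𝓕 (𝓝 0) ∧ ∀ᶠ i in (𝓕 : Filter ι), a i = b i * s i) ∨
    (∃ (t0 : ℝ) (t : ι → ℝ), Tendsto t 𝓕 (𝓝 t0) ∧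
      ∀ᶠ i in (𝓕 : Filter ι), a i ≠ 0 ∧ b i = a i * t i) := by
  by_cases ha : ∀ᶠ i in (𝓕 : Filter ι), a i = 0
  · exact Or.inl ⟨fun _ => 0, tendsto_const_nhds, by simpa using ha⟩
  have ha' : ∀ᶠ i in (𝓕 : Filter ι), a i ≠ 0 := Ultrafilter.eventually_not.2 ha
  by_cases hb : ∀ᶠ i in (𝓕 : Filter ι), b i = 0
  · refine Or.inr ⟨0, fun _ => 0, tendsto_const_nhds, ?_⟩
    filter_upwards [ha', hb] with i h1 h2
    exact ⟨h1, by simp [h2]⟩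
  have hb' : ∀ᶠ i in (𝓕 : Filter ι), b i ≠ 0 := Ultrafilter.eventually_not.2 hb
  by_cases hr : Tendsto (fun i => a i / b i) 𝓕 (𝓝 0)
  · refine Or.inl ⟨_, hr, ?_⟩
    filter_upwards [hb'] with i h1
    field_simp
  · right
    rw [Metric.tendsto_nhds] at hr
    push Not at hr
    obtain ⟨ε, hε, hfr⟩ := hr
    have hev : ∀ᶠ i in (𝓕 : Filter ι), ¬ dist (a i / b i) 0 < ε := by
      simpa using hfr
    have hmem : ∀ᶠ i in (𝓕 : Filter ι), b i / a i ∈ Metric.closedBall (0:ℝ) (1 / ε) := by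
      filter_upwards [hev, ha', hb'] with i h1 h2 h3
      rw [Metric.mem_closedBall, dist_zero_right]
      rw [not_lt, dist_zero_right, norm_div] at h1
      rw [norm_div]
      have h2' : 0 < ‖a i‖ := norm_pos_iff.2 h2
      have h3' : 0 < ‖b i‖ := norm_pos_iff.2 h3
      rw [le_div_iff₀ h3'] at h1
      rw [div_le_div_iff₀ h2' hε]
      linarith
    obtain ⟨t0, -, ht0⟩ := (isCompact_closedBall (0:ℝ) (1 / ε)).ultrafilter_le_nhds'
      (𝓕.map fun i => b i / a i) hmem
    refine ⟨t0, fun i => b i / a i, ht0, ?_⟩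
    filter_upwards [ha'] with i h1
    exact ⟨h1, by field_simp⟩

lemma power_lift {X : ι → κ → ℝ} (hX : Tendsto X 𝓕 (𝓝 0)) {N : ℕ} (hN : N ≠ 0) :
    ∃ (s : κ → ℝ) (Y : ι → κ → ℝ), (∀ k, s k ≠ 0) ∧ Lift 𝓕 X (fun z k => s k * z k ^ N) Y := by
  have hs : ∀ k, ∃ s : ℝ, s ≠ 0 ∧ ∀ᶠ i in (𝓕 : Filter ι), s * |X i k| = X i k := by
    intro k
    by_cases h : ∀ᶠ i in (𝓕 : Filter ι), 0 ≤ X i k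
    · exact ⟨1, one_ne_zero, h.mono fun i hi => by rw [abs_of_nonneg hi, one_mul]⟩
    · refine ⟨-1, by norm_num, (Ultrafilter.eventually_not.2 h).mono fun i hi => ?_⟩
      rw [abs_of_neg (not_le.1 hi)]; ring
  choose s hs0 hsX using hs
  refine ⟨s, fun i k => |X i k| ^ (1 / (N:ℝ)), hs0, ?_, ?_, ?_, ?_⟩
  · refine (analyticAt_pi_iff (f := fun k (z : κ → ℝ) => s k * z k ^ N)).2 fun k => ?_
    exact analyticAt_const.mul ((analyticAt_coord k 0).fun_pow N)
  · ext k; simp [hN]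
  · rw [tendsto_pi_nhds]
    intro k
    have h1 : Tendsto (fun i => X i k) 𝓕 (𝓝 0) := ((continuous_apply k).tendsto (0 : κ → ℝ)).comp hX
    have h2 := h1.abs
    have h3 := h2.rpow_const (p := 1 / (N:ℝ)) (Or.inr (by positivity))
    rw [abs_zero, Real.zero_rpow (by positivity)] at h3
    exact h3
  · filter_upwards [eventually_all.2 hsX] with i hi
    ext k
    have : (|X i k| ^ (1 / (N:ℝ))) ^ N = |X i k| := by
      rw [one_div]; exact Real.rpow_inv_natCast_pow (abs_nonneg _) hN
    rw [this, hi]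

lemma MUe.comp_power {α : κ → ℕ} {g : (κ → ℝ) → ℝ} (hg : MUe α g) {s : κ → ℝ}
    (hs : ∀ k, s k ≠ 0) {N : ℕ} (hN : N ≠ 0) : MUe (N • α) (fun z => g (fun k => s k * z k ^ N)) := by
  obtain ⟨u, hu, hu0, hgu⟩ := hg
  have han : AnalyticAt ℝ (fun (z : κ → ℝ) k => s k * z k ^ N) 0 :=
    (analyticAt_pi_iff (f := fun k (z : κ → ℝ) => s k * z k ^ N)).2 fun k =>
      analyticAt_const.mul ((analyticAt_coord k 0).fun_pow N)
  have h0 : (fun k => s k * (0 : κ → ℝ) k ^ N) = 0 := by ext k; simp [hN]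
  refine ⟨fun z => mon α s * u (fun k => s k * z k ^ N), ?_, ?_, ?_⟩
  · exact analyticAt_const.mul (AnalyticAt.fun_comp (by rwa [h0]) han)
  · show mon α s * u (fun k => s k * (0 : κ → ℝ) k ^ N) ≠ 0
    rw [h0]
    exact mul_ne_zero (Finset.prod_ne_zero_iff.2 fun i _ => pow_ne_zero _ (hs i)) hu0
  · have ht : Tendsto (fun (z : κ → ℝ) k => s k * z k ^ N) (𝓝 0) (𝓝 0) := by
      have := han.continuousAt.tendsto
      rwa [h0] at this
    filter_upwards [ht.eventually hgu] with z hz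
    rw [hz, mon_nsmul]
    have : mon α (fun k => s k * z k ^ N) = mon α s * mon α z ^ N := by
      simp only [mon, mul_pow, Finset.prod_mul_distrib, ← Finset.prod_pow]
      congr 1
      refine Finset.prod_congr rfl fun i _ => ?_
      rw [← pow_mul, ← pow_mul, mul_comm]
    rw [this]; ring

variable [DecidableEq κ]

lemma analyticAt_update {g : (κ → ℝ) → ℝ} {a : κ → ℝ} (hg : AnalyticAt ℝ g a) (k : κ) :
    AnalyticAt ℝ (fun z => Function.update z k (g z)) a := by
  refine (analyticAt_pi_iff (f := fun i z => Function.update z k (g z) i)).2 fun i => ?_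
  by_cases hik : i = k
  · subst hik; simpa using hg
  · simpa [hik] using analyticAt_coord i a

lemma update_zero_zero (k : κ) : Function.update (0 : κ → ℝ) k 0 = 0 := by
  ext i; by_cases hik : i = k <;> simp [Function.update_apply, hik]

lemma mon_update {β : κ → ℕ} {o : κ} (h : β o = 0) (z : κ → ℝ) (c : ℝ) :
    mon β (Function.update z o c) = mon β z := by
  refine Finset.prod_congr rfl fun i _ => ?_
  by_cases hio : i = o
  · subst hio; simp [h]
  · simp [hio]

lemma tendsto_update {X : ι → κ → ℝ} (hX : Tendsto X 𝓕 (𝓝 0)) {s : ι → ℝ}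
    (hs : Tendsto s 𝓕 (𝓝 0)) (k : κ) :
    Tendsto (fun i => Function.update (X i) k (s i)) 𝓕 (𝓝 0) := by
  have := hX.update k hs
  rwa [update_zero_zero] at this

lemma split_exponent {β : κ → ℕ} {k : κ} (h : β k ≠ 0) : ∃ β' : κ → ℕ,
    β = β' + Pi.single k 1 ∧ ∑ i, β i = ∑ i, β' i + 1 ∧ ∀ o, o ≠ k → β' o = β o := by
  have hα' : β = (fun i => β i - (Pi.single k 1 : κ → ℕ) i) + Pi.single k 1 := by
    ext i
    by_cases hik : i = k
    · subst hik; simp; omega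
    · simp [hik]
  refine ⟨_, hα', ?_, ?_⟩
  · conv_lhs => rw [hα']
    simp [Finset.sum_add_distrib]
  · intro o ho; simp [ho]

lemma ratio_lemma (o : κ) : ∀ (N : ℕ) (β : κ → ℕ), ∑ i, β i = N → β o = 0 →
    ∀ (X : ι → κ → ℝ) (s : ι → ℝ), Tendsto X 𝓕 (𝓝 0) → Tendsto s 𝓕 (𝓝 0) →
    (∀ᶠ i in (𝓕 : Filter ι), mon β (X i) = X i o * s i) →
    ∃ (p : (κ → ℝ) → κ → ℝ) (Y : ι → κ → ℝ) (m : (κ → ℝ) → ℝ), Lift 𝓕 X p Y ∧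
      AnalyticAt ℝ m 0 ∧ m 0 = 0 ∧ (∀ᶠ z in 𝓝 0, mon β (p z) = p z o * m z) ∧
      ∀ i, MU (fun z => p z i) := by
  intro N
  induction N with
  | zero =>
    intro β hβ hβo X s hX hs h
    exfalso
    have hβ0 : β = 0 := by
      ext i
      exact (Finset.sum_eq_zero_iff.1 hβ) i (Finset.mem_univ i)
    subst hβ0
    simp only [mon_zero] at h
    have h1 : Tendsto (fun i => X i o * s i) 𝓕 (𝓝 (0 * 0)) :=
      (((continuous_apply o).tendsto (0 : κ → ℝ)).comp hX).mul hs
    have h2 : Tendsto (fun i => X i o * s i) 𝓕 (𝓝 1) :=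
      tendsto_const_nhds.congr' h
    have := tendsto_nhds_unique h1 h2
    simp at this
  | succ N ih =>
    intro β hβ hβo X s hX hs h
    obtain ⟨k, hk⟩ : ∃ k, β k ≠ 0 := by
      by_contra hcon
      push Not at hcon
      simp [hcon] at hβ
    have hok : o ≠ k := fun h' => hk (h' ▸ hβo)
    obtain ⟨β', hββ', hsum, hβ'o⟩ := split_exponent hk
    have hβ'o := (hβ'o o hok).trans hβo
    have hmonβ : ∀ z, mon β z = mon β' z * z k := by
      intro z; rw [hββ', mon_add, mon_single]
    rcases dichotomy (𝓕 := 𝓕) (fun i => X i k) (fun i => X i o) with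
      ⟨s', hs', hXs⟩ | ⟨t0, t, ht, hXt⟩
    · have han : AnalyticAt ℝ (fun z : κ → ℝ => Function.update z k (z o * z k)) 0 :=
        analyticAt_update ((analyticAt_coord o 0).mul (analyticAt_coord k 0)) k
      refine ⟨fun z => Function.update z k (z o * z k), fun i => Function.update (X i) k (s' i),
        fun z => mon β' (Function.update z k (z o * z k)) * z k, ?_, ?_, ?_, ?_, ?_⟩
      · refine ⟨han, ?_, tendsto_update hX hs' k, ?_⟩
        · simp [update_zero_zero]
        · filter_upwards [hXs] with i hi
          ext j
          by_cases hjk : j = k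
          · subst hjk; simp [hok, hi]
          · simp [hjk]
      · exact ((analyticAt_mon β' _).fun_comp han).mul (analyticAt_coord k 0)
      · simp
      · refine Eventually.of_forall fun z => ?_
        simp only [hmonβ, Function.update_self, Function.update_of_ne hok]
        ring
      · intro j
        by_cases hjk : j = k
        · subst hjk; simpa using (MU.coord o).mul (MU.coord j)
        · simpa [hjk] using MU.coord j
    · have han : AnalyticAt ℝ (fun z : κ → ℝ => Function.update z o (z k * (t0 + z o))) 0 :=
        analyticAt_update ((analyticAt_coord k 0).mul
          (analyticAt_const.add (analyticAt_coord o 0))) o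
      have hlift : Lift 𝓕 X (fun z : κ → ℝ => Function.update z o (z k * (t0 + z o)))
          (fun i => Function.update (X i) o (t i - t0)) := by
        refine ⟨han, ?_, tendsto_update hX (by simpa using ht.sub_const t0) o, ?_⟩
        · simp [update_zero_zero]
        · filter_upwards [hXt] with i hi
          ext j
          by_cases hjo : j = o
          · subst hjo; simp [hok.symm, hi.2]
          · simp [hjo]
      by_cases ht0 : t0 = 0
      · subst ht0
        obtain ⟨p', Y', m, hL, hm, hm0, hmp, hMU⟩ := ih β' (by omega) hβ'o
          (fun i => Function.update (X i) o (t i - 0)) s hlift.tend hs (by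
            filter_upwards [h, hXt] with i h1 h2
            rw [mon_update hβ'o]
            simp only [Function.update_self, sub_zero]
            rw [hmonβ, h2.2] at h1
            exact mul_right_cancel₀ h2.1 (by linear_combination h1))
        refine ⟨_, Y', m, hlift.comp hL, hm, hm0, ?_, ?_⟩
        · filter_upwards [hmp] with z hz
          rw [mon_update hβo, hmonβ, hz]
          simp only [Function.update_self, zero_add]
          ring
        · intro j
          by_cases hjo : j = o
          · subst hjo; simpa using (hMU k).mul (hMU j)
          · simpa [hjo] using hMU j
      · have hunit : AnalyticAt ℝ (fun z : κ → ℝ => (t0 + z o)) 0 :=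
          analyticAt_const.add (analyticAt_coord o 0)
        have hman : AnalyticAt ℝ (fun z : κ → ℝ => mon β' z * (t0 + z o)⁻¹) 0 :=
          (analyticAt_mon β' 0).mul (hunit.inv (by simpa using ht0))
        have hne : ∀ᶠ z in 𝓝 (0 : κ → ℝ), t0 + z o ≠ 0 :=
          hunit.continuousAt.eventually_ne (by simpa using ht0)
        have hmp : ∀ᶠ z in 𝓝 (0 : κ → ℝ), mon β (Function.update z o (z k * (t0 + z o))) =
            Function.update z o (z k * (t0 + z o)) o * (mon β' z * (t0 + z o)⁻¹) := by
          filter_upwards [hne] with z hz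
          rw [mon_update hβo, hmonβ, Function.update_self]
          field_simp
        refine ⟨_, _, _, hlift, hman, ?_, hmp, ?_⟩
        · refine tendsto_nhds_unique (hman.continuousAt.tendsto.comp hlift.tend) (hs.congr' ?_)
          filter_upwards [hlift.tend.eventually hmp, hlift.eq, h, hXt,
            ht.eventually_ne ht0] with i h1 h2 h3 h4 h5
          rw [h2, h3] at h1
          have : X i o ≠ 0 := by rw [h4.2]; exact mul_ne_zero h4.1 h5
          exact mul_left_cancel₀ this h1
        · intro j
          by_cases hjo : j = o
          · subst hjo
            simpa using (MU.coord k).mul (MU.of_unit hunit (by simpa using ht0))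
          · simpa [hjo] using MU.coord j

end lifts
end GF

namespace GF
open Topology

section prep
variable {ι : Type*} 

/-- Monomialization of germs in `n` variables along families converging along `𝓕`. -/
def Mono (𝓕 : Ultrafilter ι) (n : ℕ) : Prop :=
  ∀ F : (Fin n → ℝ) → ℝ, AnalyticAt ℝ F 0 → (¬ ∀ᶠ x in 𝓝 0, F x = 0) →
    ∀ X : ι → Fin n → ℝ, Tendsto X 𝓕 (𝓝 0) →
      ∃ (p : (Fin n → ℝ) → Fin n → ℝ) (Y : ι → Fin n → ℝ), Lift 𝓕 X p Y ∧ MU (fun z => F (p z))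

variable {𝓕 : Ultrafilter ι}

lemma not_eventually_zero_mul {V : Type*} [NormedAddCommGroup V] [NormedSpace ℝ V]
    {f g : V → ℝ} (hf : AnalyticAt ℝ f 0) (hg : AnalyticAt ℝ g 0)
    (hf0 : ¬ ∀ᶠ x in 𝓝 0, f x = 0) (hg0 : ¬ ∀ᶠ x in 𝓝 0, g x = 0) :
    ¬ ∀ᶠ x in 𝓝 0, f x * g x = 0 := fun h =>
  (eventually_zero_of_mul hf hg h).elim hf0 hg0

lemma not_eventually_zero_prod {V : Type*} [NormedAddCommGroup V] [NormedSpace ℝ V] {σ : Type*}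
    (s : Finset σ) {f : σ → V → ℝ} (hf : ∀ j ∈ s, AnalyticAt ℝ (f j) 0)
    (hf0 : ∀ j ∈ s, ¬ ∀ᶠ x in 𝓝 0, f j x = 0) :
    ¬ ∀ᶠ x in 𝓝 0, ∏ j ∈ s, f j x = 0 := by
  classical
  induction s using Finset.induction_on with
  | empty => simpa using (NeBot.ne (f := 𝓝 (0 : V)) inferInstance)
  | insert a s ha ih =>
    simp only [Finset.prod_insert ha]
    exact not_eventually_zero_mul (hf a (by simp))
      (Finset.analyticAt_fun_prod _ fun i hi => hf i (by simp [hi])) (hf0 a (by simp))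
      (ih (fun j hj => hf j (by simp [hj])) (fun j hj => hf0 j (by simp [hj])))

lemma MUe.comparable' {κ : Type*} [Fintype κ] {α β : κ → ℕ} {f g : (κ → ℝ) → ℝ}
    (hf : MUe α f) (hg : MUe β g)
    (hfg : MU (fun x => f x - g x) ∨ ∀ᶠ x in 𝓝 0, f x - g x = 0) : α ≤ β ∨ β ≤ α := by
  rcases hfg with ⟨γ, hγ⟩ | h
  · exact hf.comparable hg hγ
  · have h1 : MUe (0 + β) (fun x => (fun _ => (2:ℝ)) x * g x) :=
      (MUe.of_unit analyticAt_const two_ne_zero).mul hg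
    have h2 : MUe (0 + α) (fun x => (fun _ => (-1:ℝ)) x * f x) :=
      (MUe.of_unit analyticAt_const (by norm_num)).mul hf
    rw [zero_add] at h1 h2
    refine hf.comparable h1 (h2.congr ?_)
    filter_upwards [h] with x hx
    linear_combination (-2) * (-hx)

lemma prep {n d : ℕ} (hM : Mono 𝓕 n) (c : ℕ → (Fin n → ℝ) → ℝ)
    (hc : ∀ i < d, AnalyticAt ℝ (c i) 0) (hc0 : ∀ i < d, c i 0 = 0)
    (hex : ∃ i < d, ¬ ∀ᶠ x in 𝓝 0, c i x = 0) (X : ι → Fin n → ℝ) (hX : Tendsto X 𝓕 (𝓝 0)) :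
    ∃ (P : (Fin n → ℝ) → Fin n → ℝ) (W : ι → Fin n → ℝ) (β : Fin n → ℕ)
      (c' : ℕ → (Fin n → ℝ) → ℝ), Lift 𝓕 X P W ∧ (∀ k, MU (fun z => P z k)) ∧ β ≠ 0 ∧
      (∀ i < d, AnalyticAt ℝ (c' i) 0 ∧
        ∀ᶠ x in 𝓝 0, c i (P x) = mon ((d - i) • β) x * c' i x) ∧
      (∃ i < d, c' i 0 ≠ 0) ∧ (∀ i < d, (∀ᶠ x in 𝓝 0, c i x = 0) → c' i = 0) := by
  classical
  let S := (Finset.range d).filter (fun i => ¬ ∀ᶠ x in 𝓝 0, c i x = 0)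
  have hS : ∀ i, i ∈ S ↔ i < d ∧ ¬ ∀ᶠ x in 𝓝 0, c i x = 0 := by intro i; simp [S]
  have hSd : ∀ i ∈ S, i < d := fun i hi => ((hS i).1 hi).1
  let N := d.factorial
  have hN : N ≠ 0 := Nat.factorial_ne_zero d
  let e : ℕ → ℕ := fun i => N / (d - i)
  have he : ∀ i < d, (d - i) * e i = N := fun i hi =>
    Nat.mul_div_cancel' (Nat.dvd_factorial (by omega) (by omega))
  have he0 : ∀ i < d, e i ≠ 0 := fun i hi h => hN (by rw [← he i hi, h, mul_zero])
  have hA : ∀ i < d, AnalyticAt ℝ (fun x => c i x ^ e i) 0 := fun i hi => (hc i hi).fun_pow _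
  let T := (S ×ˢ S).filter (fun ij => ¬ ∀ᶠ x in 𝓝 0, c ij.1 x ^ e ij.1 - c ij.2 x ^ e ij.2 = 0)
  have hT : ∀ ij, ij ∈ T ↔ (ij.1 ∈ S ∧ ij.2 ∈ S) ∧
    ¬ ∀ᶠ x in 𝓝 0, c ij.1 x ^ e ij.1 - c ij.2 x ^ e ij.2 = 0 := by intro ij; simp [T]
  have an1 : AnalyticAt ℝ (fun x : Fin n → ℝ => ∏ k, x k) 0 :=
    Finset.analyticAt_fun_prod _ fun i _ => analyticAt_coord i 0
  have an2 : AnalyticAt ℝ (fun x => ∏ i ∈ S, c i x) 0 :=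
    Finset.analyticAt_fun_prod _ fun i hi => hc i (hSd i hi)
  have anT : ∀ ij ∈ T, AnalyticAt ℝ (fun x => c ij.1 x ^ e ij.1 - c ij.2 x ^ e ij.2) 0 :=
    fun ij hij => (hA _ (hSd _ ((hT ij).1 hij).1.1)).sub (hA _ (hSd _ ((hT ij).1 hij).1.2))
  have an3 : AnalyticAt ℝ (fun x => ∏ ij ∈ T, (c ij.1 x ^ e ij.1 - c ij.2 x ^ e ij.2)) 0 :=
    Finset.analyticAt_fun_prod _ anT
  have hF0 := not_eventually_zero_mul an1 (an2.mul an3)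
    (not_eventually_zero_prod _ (fun i _ => analyticAt_coord i 0)
      (fun i _ => not_eventually_coord i))
    (not_eventually_zero_mul an2 an3
      (not_eventually_zero_prod _ (fun i hi => hc i (hSd i hi)) (fun i hi => ((hS i).1 hi).2))
      (not_eventually_zero_prod _ anT (fun ij hij => ((hT ij).1 hij).2)))
  obtain ⟨p, Y, hL, hMU⟩ := hM _ (an1.mul (an2.mul an3)) hF0 X hX
  have cmp : ∀ {g : (Fin n → ℝ) → ℝ}, AnalyticAt ℝ g 0 → AnalyticAt ℝ (fun z => g (p z)) 0 :=
    fun {g} hg => AnalyticAt.fun_comp (by rwa [hL.zero]) hL.an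
  have m1 : MU (fun z => ∏ k, p z k) := MU.of_mul (cmp an1) (cmp (an2.mul an3)) hMU
  have m23 : MU (fun z => (∏ i ∈ S, c i (p z)) *
      ∏ ij ∈ T, (c ij.1 (p z) ^ e ij.1 - c ij.2 (p z) ^ e ij.2)) :=
    MU.of_mul (cmp (an2.mul an3)) (cmp an1)
      (hMU.congr (Eventually.of_forall fun z => mul_comm _ _))
  have m2 : MU (fun z => ∏ i ∈ S, c i (p z)) := MU.of_mul (cmp an2) (cmp an3) m23
  have m3 : MU (fun z => ∏ ij ∈ T, (c ij.1 (p z) ^ e ij.1 - c ij.2 (p z) ^ e ij.2)) :=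
    MU.of_mul (cmp an3) (cmp an2) (m23.congr (Eventually.of_forall fun z => mul_comm _ _))
  have m1' := MU.of_prod _ (f := fun k z => p z k) (fun k _ => cmp (analyticAt_coord k 0)) m1
  have m2' := MU.of_prod _ (f := fun i z => c i (p z)) (fun i hi => cmp (hc i (hSd i hi))) m2
  have m3' := MU.of_prod _
    (f := fun (ij : ℕ × ℕ) z => c ij.1 (p z) ^ e ij.1 - c ij.2 (p z) ^ e ij.2)
    (fun ij hij => cmp (anT ij hij)) m3
  have hα : ∀ i, ∃ α, i ∈ S → MUe α (fun z => c i (p z)) := by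
    intro i
    by_cases hi : i ∈ S
    · obtain ⟨α, h⟩ := m2' i hi
      exact ⟨α, fun _ => h⟩
    · exact ⟨0, fun h => absurd h hi⟩
  choose α hα using hα
  have hcomp : ∀ i ∈ S, ∀ j ∈ S, e i • α i ≤ e j • α j ∨ e j • α j ≤ e i • α i := by
    intro i hi j hj
    refine MUe.comparable' ((hα i hi).pow (e i)) ((hα j hj).pow (e j)) ?_
    by_cases hij : (i, j) ∈ T
    · exact Or.inl (m3' (i, j) hij)
    · right
      have : ∀ᶠ x in 𝓝 0, c i x ^ e i - c j x ^ e j = 0 := by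
        by_contra hcon
        exact hij ((hT (i, j)).2 ⟨⟨hi, hj⟩, hcon⟩)
      exact hL.tendsto.eventually this
  have hSne : S.Nonempty := by
    obtain ⟨i, hi, h⟩ := hex
    exact ⟨i, (hS i).2 ⟨hi, h⟩⟩
  obtain ⟨i0, hi0, hmin⟩ := Finset.exists_minimalFor (fun i => e i • α i) S hSne
  have hle : ∀ j ∈ S, e i0 • α i0 ≤ e j • α j := by
    intro j hj
    rcases hcomp i0 hi0 j hj with h | h
    · exact h
    · exact hmin hj h
  have hα0 : α i0 ≠ 0 := by
    intro h
    obtain ⟨u, hu, hu0, hgu⟩ := hα i0 hi0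
    have := hgu.self_of_nhds
    rw [h, mon_zero, one_mul] at this
    beta_reduce at this
    rw [hL.zero, hc0 i0 (hSd i0 hi0)] at this
    exact hu0 this.symm
  obtain ⟨s, Y', hs, hL2⟩ := power_lift hL.tend hN
  have hδ : ∀ j, ∃ c' : (Fin n → ℝ) → ℝ, (j ∈ S → AnalyticAt ℝ c' 0 ∧ 
      (∀ᶠ x in 𝓝 0, c j (p (fun k => s k * x k ^ N)) = mon ((d - j) • (e i0 • α i0)) x * c' x) ∧
      (j = i0 → c' 0 ≠ 0)) ∧ (j ∉ S → c' = 0) := by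
    intro j
    by_cases hj : j ∈ S
    · obtain ⟨u, hu, hu0, hgu⟩ := (hα j hj).comp_power hs hN
      have hle' : (d - j) • (e i0 • α i0) ≤ N • α j := by
        rw [← he j (hSd j hj), mul_smul]
        exact nsmul_le_nsmul_right (hle j hj) _
      refine ⟨fun x => mon (N • α j - (d - j) • (e i0 • α i0)) x * u x,
        fun _ => ⟨(analyticAt_mon _ _).mul hu, ?_, ?_⟩, fun h => absurd hj h⟩
      · filter_upwards [hgu] with x hx
        rw [hx, ← mul_assoc, ← mon_add, add_tsub_cancel_of_le hle']
      · rintro rfl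
        rw [← mul_smul, he j (hSd j hj), tsub_self]
        beta_reduce
        rw [mon_zero, one_mul]
        exact hu0
    · exact ⟨0, fun h => absurd h hj, fun _ => rfl⟩
  choose c' hc' hc'0 using hδ
  refine ⟨_, Y', e i0 • α i0, c', hL.comp hL2, ?_, ?_, ?_, ⟨i0, hSd i0 hi0, ?_⟩, ?_⟩
  · intro k
    obtain ⟨δ, hδ⟩ := m1' k (Finset.mem_univ k)
    exact ⟨_, hδ.comp_power hs hN⟩
  · exact smul_ne_zero (he0 i0 (hSd i0 hi0)) hα0
  · intro j hj
    by_cases hjS : j ∈ S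
    · exact ⟨(hc' j hjS).1, (hc' j hjS).2.1⟩
    · rw [hc'0 j hjS]
      refine ⟨analyticAt_const, ?_⟩
      have : ∀ᶠ x in 𝓝 0, c j x = 0 := by
        by_contra hcon
        exact hjS ((hS j).2 ⟨hj, hcon⟩)
      filter_upwards [(hL.comp hL2).tendsto.eventually this] with x hx
      rw [hx]; simp
  · exact (hc' i0 hi0).2.2 rfl
  · intro j hj hz
    exact hc'0 j (fun h => ((hS j).1 h).2 hz)

end prep
end GF

namespace GF
open Topology

section tsch

lemma poly_zero : ∀ (d : ℕ) (a : ℕ → ℝ) (W : ℝ → ℝ) (w : ℝ), Tendsto W (𝓝[≠] 0) (𝓝 w) →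
    (∀ᶠ y in 𝓝[≠] (0:ℝ), ∑ i ∈ Finset.range d, a i * y ^ i = y ^ d * W y) →
    ∀ i < d, a i = 0 := by
  intro d
  induction d with
  | zero => intro a W w _ _ i hi; omega
  | succ d ih =>
    intro a W w hW h
    have hpow : ∀ (k : ℕ), Tendsto (fun y : ℝ => y ^ k) (𝓝[≠] 0) (𝓝 (0 ^ k)) := fun k =>
      ((continuous_pow _).tendsto 0).mono_left nhdsWithin_le_nhds
    have ha0 : a 0 = 0 := by
      have h1 : Tendsto (fun y : ℝ => ∑ i ∈ Finset.range (d + 1), a i * y ^ i) (𝓝[≠] 0)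
          (𝓝 (∑ i ∈ Finset.range (d + 1), a i * 0 ^ i)) :=
        tendsto_finsetSum _ fun i _ => (hpow i).const_mul _
      have h2 := tendsto_nhds_unique (h1.congr' h) ((hpow (d + 1)).mul hW)
      simpa [Finset.sum_range_succ'] using h2
    have h' := ih (fun i => a (i + 1)) W w hW (by
      filter_upwards [h, self_mem_nhdsWithin] with y hy hy0
      rw [Finset.sum_range_succ', ha0, zero_mul, add_zero] at hy
      refine mul_left_cancel₀ (a := y) hy0 ?_
      rw [Finset.mul_sum]
      calc _ = ∑ k ∈ Finset.range d, a (k + 1) * y ^ (k + 1) :=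
            Finset.sum_congr rfl fun i _ => by ring
        _ = _ := by rw [hy]; ring)
    intro i hi
    cases i with
    | zero => exact ha0
    | succ i => exact h' i (by omega)

lemma taylor_div {V : Type*} [NormedAddCommGroup V] [NormedSpace ℝ V] {G : V → ℝ}
    (hG : AnalyticAt ℝ G 0) (ℓ : V →L[ℝ] ℝ) (e : V) (d : ℕ) :
    ∃ (C : ℕ → V → ℝ) (U : V → ℝ), (∀ i, AnalyticAt ℝ (C i) 0) ∧ AnalyticAt ℝ U 0 ∧
      ∀ᶠ z in 𝓝 0, G z = ∑ i ∈ Finset.range d, C i (z - ℓ z • e) * ℓ z ^ i + ℓ z ^ d * U z := by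
  induction d with
  | zero => exact ⟨fun _ => G, G, fun _ => hG, hG, by simp⟩
  | succ d ih =>
    obtain ⟨C, U, hC, hU, h⟩ := ih
    obtain ⟨q, hq, hqe⟩ := exists_division hU ℓ e
    refine ⟨fun i => if i = d then U else C i, q, ?_, hq, ?_⟩
    · intro i
      by_cases hi : i = d
      · simpa [hi] using hU
      · simpa [hi] using hC i
    · filter_upwards [h, hqe] with z h1 h2
      rw [h1, Finset.sum_range_succ]
      have : ∑ i ∈ Finset.range d, (if i = d then U else C i) (z - ℓ z • e) * ℓ z ^ i =
          ∑ i ∈ Finset.range d, C i (z - ℓ z • e) * ℓ z ^ i := by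
        refine Finset.sum_congr rfl fun i hi => ?_
        rw [if_neg (Finset.mem_range.1 hi).ne]
      rw [this, if_pos rfl]
      nth_rewrite 1 [h2]
      ring

/-- Put a coordinate in front. -/
def cs {n : ℕ} (t : ℝ) (x : Fin n → ℝ) : Fin (n + 1) → ℝ := Fin.cons t x

@[simp] lemma cs_zero {n : ℕ} (t : ℝ) (x : Fin n → ℝ) : cs t x 0 = t := rfl
@[simp] lemma cs_succ {n : ℕ} (t : ℝ) (x : Fin n → ℝ) (k : Fin n) : cs t x k.succ = x k := rfl
@[simp] lemma tail_cs {n : ℕ} (t : ℝ) (x : Fin n → ℝ) : Fin.tail (cs t x) = x := rfl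
@[simp] lemma cs_self_tail {n : ℕ} (z : Fin (n + 1) → ℝ) : cs (z 0) (Fin.tail z) = z :=
  Fin.cons_self_tail z
@[simp] lemma cs_zero_zero {n : ℕ} : cs 0 (0 : Fin n → ℝ) = 0 := by
  ext i; refine Fin.cases ?_ (fun k => ?_) i <;> simp
@[simp] lemma tail_zero' {n : ℕ} : Fin.tail (0 : Fin (n + 1) → ℝ) = 0 := rfl

lemma analyticAt_cs {V : Type*} [NormedAddCommGroup V] [NormedSpace ℝ V] {n : ℕ} {g : V → ℝ}
    {h : V → Fin n → ℝ} {a : V} (hg : AnalyticAt ℝ g a) (hh : AnalyticAt ℝ h a) :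
    AnalyticAt ℝ (fun z => cs (g z) (h z)) a := by
  refine (analyticAt_pi_iff (f := fun i z => cs (g z) (h z) i)).2 fun i => ?_
  refine Fin.cases ?_ (fun k => ?_) i
  · simpa using hg
  · simpa using (analyticAt_pi_iff (f := fun i z => h z i)).1 hh k

lemma analyticAt_tail {n : ℕ} (a : Fin (n + 1) → ℝ) :
    AnalyticAt ℝ (fun z : Fin (n + 1) → ℝ => Fin.tail z) a :=
  (analyticAt_pi_iff (f := fun i (z : Fin (n + 1) → ℝ) => Fin.tail z i)).2 fun i =>
    analyticAt_coord i.succ a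

lemma tschirnhaus {n d : ℕ} {f : (Fin (n + 1) → ℝ) → ℝ} (hf : AnalyticAt ℝ f 0) (hd : d ≠ 0)
    {v : ℝ → ℝ} (hv : AnalyticAt ℝ v 0) (hv0 : v 0 ≠ 0)
    (hfv : ∀ᶠ t in 𝓝 (0:ℝ), f (cs t 0) = t ^ d * v t) :
    ∃ (φ : (Fin n → ℝ) → ℝ) (c : ℕ → (Fin n → ℝ) → ℝ) (U : (Fin (n + 1) → ℝ) → ℝ),
      AnalyticAt ℝ φ 0 ∧ φ 0 = 0 ∧ (∀ i < d, AnalyticAt ℝ (c i) 0) ∧ (∀ i < d, c i 0 = 0) ∧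
      (∀ᶠ x in 𝓝 0, c (d - 1) x = 0) ∧ AnalyticAt ℝ U 0 ∧ U 0 ≠ 0 ∧
      ∀ᶠ z in 𝓝 0, f (cs (φ (Fin.tail z) + z 0) (Fin.tail z)) =
        ∑ i ∈ Finset.range d, c i (Fin.tail z) * z 0 ^ i + z 0 ^ d * U z := by
  let V := (Fin n → ℝ) × ℝ × ℝ
  let ℓ : V →L[ℝ] ℝ := (ContinuousLinearMap.snd ℝ ℝ ℝ).comp
    (ContinuousLinearMap.snd ℝ (Fin n → ℝ) (ℝ × ℝ))
  let e : V := (0, 0, 1)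
  have hproj : ∀ x s y, ((x, s, y) : V) - ℓ (x, s, y) • e = (x, s, 0) := by
    intro x s y
    show (x - y • (0 : Fin n → ℝ), s - y • (0:ℝ), y - y • (1:ℝ)) = (x, s, 0)
    simp
  have hG : AnalyticAt ℝ (fun z : V => f (cs (z.2.1 + z.2.2) z.1)) 0 := by
    refine AnalyticAt.fun_comp (g := f) (by simpa using hf) ?_
    refine analyticAt_cs ?_ analyticAt_fst
    exact (analyticAt_fst.fun_comp analyticAt_snd).add (analyticAt_snd.fun_comp analyticAt_snd)
  obtain ⟨C, U, hC, hU, hE⟩ := taylor_div hG ℓ e d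
  have hE' : ∀ᶠ z in 𝓝 (0 : V), f (cs (z.2.1 + z.2.2) z.1) =
      ∑ i ∈ Finset.range d, C i (z.1, z.2.1, 0) * z.2.2 ^ i + z.2.2 ^ d * U z := by
    filter_upwards [hE] with z hz
    obtain ⟨x, s, y⟩ := z
    rw [hz, hproj]; rfl
  have ty : Tendsto (fun y : ℝ => ((0, 0, y) : V)) (𝓝 0) (𝓝 0) := by
    have : Continuous (fun y : ℝ => ((0, 0, y) : V)) := by fun_prop
    exact this.tendsto 0
  have hUy : AnalyticAt ℝ (fun y : ℝ => U (0, 0, y)) 0 := by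
    refine AnalyticAt.fun_comp (g := U) hU ?_
    exact analyticAt_const.prod (analyticAt_const.prod analyticAt_id)
  -- coefficients at the origin
  have h0 : ∀ i < d, C i 0 = 0 := by
    refine poly_zero d (fun i => C i 0) (fun y => v y - U (0, 0, y)) (v 0 - U 0)
      ((hv.continuousAt.tendsto.sub hUy.continuousAt.tendsto).mono_left nhdsWithin_le_nhds) ?_
    refine Eventually.filter_mono nhdsWithin_le_nhds ?_
    filter_upwards [ty.eventually hE', hfv] with y h1 h2
    simp only [zero_add] at h1
    rw [h2] at h1
    have h3 : ((0 : Fin n → ℝ), (0:ℝ), (0:ℝ)) = 0 := rfl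
    rw [h3] at h1
    linear_combination -h1
  -- the value of U
  have hU0 : U 0 = v 0 := by
    have h1 : ∀ᶠ y in 𝓝[≠] (0:ℝ), v y = U (0, 0, y) := by
      have : ∀ᶠ y in 𝓝 (0:ℝ), y ^ d * v y = y ^ d * U (0, 0, y) := by
        filter_upwards [ty.eventually hE', hfv] with y h1 h2
        simp only [zero_add] at h1
        rw [h2] at h1
        rw [h1, Finset.sum_eq_zero, zero_add]
        intro i hi
        have h3 := h0 i (Finset.mem_range.1 hi)
        have h4 : C i ((0 : Fin n → ℝ), (0:ℝ), (0:ℝ)) = 0 := h3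
        rw [h4, zero_mul]
      filter_upwards [this.filter_mono nhdsWithin_le_nhds, self_mem_nhdsWithin] with y h1 h2
      exact mul_left_cancel₀ (pow_ne_zero d h2) h1
    refine tendsto_nhds_unique (f := fun y => v y) (l := 𝓝[≠] (0:ℝ)) ?_
      (hv.continuousAt.tendsto.mono_left nhdsWithin_le_nhds)
    exact ((hUy.continuousAt.tendsto).mono_left nhdsWithin_le_nhds).congr'
      (h1.mono fun y hy => hy.symm)
  -- the derivative of the coefficient of order d - 1
  have hD : ∀ i, AnalyticAt ℝ (fun w : (Fin n → ℝ) × ℝ => C i (w.1, w.2, 0)) 0 := fun i =>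
    AnalyticAt.fun_comp (g := C i) (hC i)
      (analyticAt_fst.prod (analyticAt_snd.prod analyticAt_const))
  let a : ℕ → ℝ := fun i => fderiv ℝ (fun w : (Fin n → ℝ) × ℝ => C i (w.1, w.2, 0)) 0 (0, 1)
  have hline : ∀ i, HasDerivAt (fun s : ℝ => C i (0, s, 0)) (a i) 0 := by
    intro i
    have h1 : HasFDerivAt (fun w : (Fin n → ℝ) × ℝ => C i (w.1, w.2, 0))
        (fderiv ℝ (fun w : (Fin n → ℝ) × ℝ => C i (w.1, w.2, 0)) 0)
        ((fun s : ℝ => ((0, s) : (Fin n → ℝ) × ℝ)) 0) :=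
      (hD i).differentiableAt.hasFDerivAt
    have h2 : HasDerivAt (fun s : ℝ => ((0, s) : (Fin n → ℝ) × ℝ)) (0, 1) 0 :=
      (hasDerivAt_const _ _).prodMk (hasDerivAt_id _)
    exact h1.comp_hasDerivAt 0 h2
  obtain ⟨w, hw, hwe⟩ := exists_division hv (ContinuousLinearMap.id ℝ ℝ) 1
  have hUs : AnalyticAt ℝ (fun y : ℝ => fderiv ℝ U (0, 0, y) (0, 1, 0)) 0 := by
    have h1 : AnalyticAt ℝ (fun z : V => fderiv ℝ U z (0, 1, 0)) 0 :=
      ((ContinuousLinearMap.apply ℝ ℝ ((0, 1, 0) : V)).analyticAt _).comp hU.fderiv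
    refine AnalyticAt.fun_comp (g := fun z : V => fderiv ℝ U z (0, 1, 0)) h1 ?_
    exact analyticAt_const.prod (analyticAt_const.prod analyticAt_id)
  have hkey : a (d - 1) = d * v 0 := by
    have := poly_zero d (fun i => a i - if i = d - 1 then d * v 0 else 0)
      (fun y => d * w y + deriv v y - fderiv ℝ U (0, 0, y) (0, 1, 0)) _
      (((((analyticAt_const.mul hw).add hv.deriv).sub hUs).continuousAt.tendsto).mono_left
        nhdsWithin_le_nhds) ?_ (d - 1) (by omega)
    · simpa [sub_eq_zero] using this
    refine Eventually.filter_mono nhdsWithin_le_nhds ?_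
    filter_upwards [ty.eventually (eventually_eventually_nhds.2 hE'),
      eventually_eventually_nhds.2 hfv, hv.eventually_analyticAt,
      ty.eventually hU.eventually_analyticAt, hwe] with y h1 h2 h3 h4 h5
    have ts : Tendsto (fun s : ℝ => ((0, s, y) : V)) (𝓝 0) (𝓝 (0, 0, y)) := by
      have : Continuous (fun s : ℝ => ((0, s, y) : V)) := by fun_prop
      exact this.tendsto 0
    have ta : Tendsto (fun s : ℝ => s + y) (𝓝 0) (𝓝 y) := by
      have : Continuous (fun s : ℝ => s + y) := by fun_prop
      simpa using this.tendsto 0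
    have e1 : (fun s : ℝ => (s + y) ^ d * v (s + y)) =ᶠ[𝓝 0] (fun s : ℝ =>
        ∑ i ∈ Finset.range d, C i (0, s, 0) * y ^ i + y ^ d * U (0, s, y)) := by
      filter_upwards [ts.eventually h1, ta.eventually h2] with s g1 g2
      rw [← g2, g1]
    have d1 : HasDerivAt (fun s : ℝ => (s + y) ^ d * v (s + y))
        (d * y ^ (d - 1) * v y + y ^ d * deriv v y) 0 := by
      have q1 : HasDerivAt (fun t : ℝ => t ^ d * v t)
          (d * y ^ (d - 1) * v y + y ^ d * deriv v y) (0 + y) := by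
        rw [zero_add]
        exact (hasDerivAt_pow d y).mul h3.differentiableAt.hasDerivAt
      exact HasDerivAt.comp_add_const 0 y q1
    have d2 : HasDerivAt (fun s : ℝ =>
        ∑ i ∈ Finset.range d, C i (0, s, 0) * y ^ i + y ^ d * U (0, s, y))
        (∑ i ∈ Finset.range d, a i * y ^ i + y ^ d * fderiv ℝ U (0, 0, y) (0, 1, 0)) 0 := by
      refine (HasDerivAt.fun_sum fun i _ => (hline i).mul_const _).add (HasDerivAt.const_mul _ ?_)
      have q2 : HasFDerivAt U (fderiv ℝ U (0, 0, y)) ((fun s : ℝ => ((0, s, y) : V)) 0) :=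
        h4.differentiableAt.hasFDerivAt
      have q3 : HasDerivAt (fun s : ℝ => ((0, s, y) : V)) (0, 1, 0) 0 :=
        (hasDerivAt_const _ _).prodMk ((hasDerivAt_id _).prodMk (hasDerivAt_const _ _))
      exact q2.comp_hasDerivAt 0 q3
    have hu := (d1.congr_of_eventuallyEq e1.symm).unique d2
    have hvy : v y = v 0 + y * w y := by simpa using h5
    have hyd : y ^ d = y ^ (d - 1) * y := by rw [← pow_succ]; congr 1; omega
    simp only [sub_mul, Finset.sum_sub_distrib, ite_mul, zero_mul]
    rw [Finset.sum_ite_eq' (Finset.range d) (d - 1), if_pos (Finset.mem_range.2 (by omega))]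
    rw [hvy] at hu
    rw [hyd] at hu ⊢
    linear_combination -hu
  -- implicit function theorem
  have hcd := (hD (d - 1)).contDiffAt (n := ⊤)
  have hinv : (fderiv ℝ (fun w : (Fin n → ℝ) × ℝ => C (d - 1) (w.1, w.2, 0)) 0 ∘L
      .inr ℝ (Fin n → ℝ) ℝ).IsInvertible := by
    have hne : a (d - 1) ≠ 0 := by
      rw [hkey]; exact mul_ne_zero (by exact_mod_cast hd) hv0
    refine ⟨ContinuousLinearEquiv.unitsEquivAut ℝ (Units.mk0 _ hne), ?_⟩
    ext
    simp [a]
  let φ := hcd.implicitFunction (by simp) hinv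
  have hφ0 : φ 0 = 0 := hcd.implicitFunction_apply_self (by simp) hinv
  have hφ : AnalyticAt ℝ φ 0 := (hcd.contDiffAt_implicitFunction (by simp) hinv).analyticAt
  have hφe : ∀ᶠ x in 𝓝 (0 : Fin n → ℝ), C (d - 1) (x, φ x, 0) = 0 := by
    have := hcd.eventually_apply_implicitFunction (by simp) hinv
    filter_upwards [this] with x hx
    exact hx.trans (h0 (d - 1) (by omega))
  have hφt : AnalyticAt ℝ (fun z : Fin (n + 1) → ℝ => φ (Fin.tail z)) 0 :=
    AnalyticAt.fun_comp (g := φ) hφ (analyticAt_tail 0)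
  have hmap : AnalyticAt ℝ
      (fun z : Fin (n + 1) → ℝ => ((Fin.tail z, φ (Fin.tail z), z 0) : V)) 0 :=
    (analyticAt_tail 0).prod (hφt.prod (analyticAt_coord 0 0))
  have hmap0 : ((Fin.tail (0 : Fin (n + 1) → ℝ), φ (Fin.tail (0 : Fin (n + 1) → ℝ)),
      (0 : Fin (n + 1) → ℝ) 0) : V) = 0 := by
    rw [tail_zero', hφ0]; rfl
  refine ⟨φ, fun i x => C i (x, φ x, 0), fun z => U (Fin.tail z, φ (Fin.tail z), z 0), hφ, hφ0,
    ?_, ?_, hφe, ?_, ?_, ?_⟩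
  · intro i _
    refine AnalyticAt.fun_comp (g := C i) ?_
      (analyticAt_id.prod (hφ.prod analyticAt_const))
    show AnalyticAt ℝ (C i) (0, φ 0, 0)
    rw [hφ0]; exact hC i
  · intro i hi
    show C i (0, φ 0, 0) = 0
    rw [hφ0]; exact h0 i hi
  · exact AnalyticAt.fun_comp (g := U) (by rw [hmap0]; exact hU) hmap
  · show U (Fin.tail (0 : Fin (n + 1) → ℝ), φ (Fin.tail (0 : Fin (n + 1) → ℝ)),
      (0 : Fin (n + 1) → ℝ) 0) ≠ 0
    rw [hmap0, hU0]; exact hv0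
  · have ht := hmap.continuousAt.tendsto
    rw [hmap0] at ht
    exact ht.eventually hE'

end tsch
end GF

namespace GF
open Topology

section mono
variable {ι : Type*} {𝓕 : Ultrafilter ι}

lemma poly_order {d : ℕ} (hd : d ≠ 0) (a : ℕ → ℝ) {u : ℝ} (hu : u ≠ 0) (ha : a (d - 1) = 0)
    (hex : ∃ i < d, a i ≠ 0) (t0 : ℝ) :
    ∃ d' < d, ∃ v : ℝ → ℝ, AnalyticAt ℝ v 0 ∧ v 0 ≠ 0 ∧ ∀ τ,
      ∑ i ∈ Finset.range d, a i * (t0 + τ) ^ i + (t0 + τ) ^ d * u = τ ^ d' * v τ := by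
  let Q : Polynomial ℝ := ∑ i ∈ Finset.range d, Polynomial.C (a i) * Polynomial.X ^ i +
    Polynomial.C u * Polynomial.X ^ d
  have hQe : ∀ T, Q.eval T = ∑ i ∈ Finset.range d, a i * T ^ i + T ^ d * u := by
    intro T
    simp [Q, Polynomial.eval_finsetSum, mul_comm u]
  have hQc : ∀ i < d, Q.coeff i = a i := by
    intro i hi
    simp only [Q, Polynomial.coeff_add, Polynomial.finsetSum_coeff, Polynomial.coeff_C_mul_X_pow]
    rw [Finset.sum_ite_eq, if_pos (Finset.mem_range.2 hi), if_neg hi.ne, add_zero]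
  have hQd : Q.coeff d = u := by
    simp [Q, Polynomial.finsetSum_coeff, Polynomial.coeff_X_pow]
  have hQ0 : Q ≠ 0 := by
    intro h; rw [h] at hQd; exact hu (by simpa using hQd.symm)
  have hQn : Q.natDegree = d := by
    refine Polynomial.natDegree_eq_of_le_of_coeff_ne_zero ?_ (by rwa [hQd])
    refine Polynomial.natDegree_add_le_of_degree_le ?_ (Polynomial.natDegree_C_mul_X_pow_le _ _)
    refine Polynomial.natDegree_sum_le_of_forall_le _ _ fun i hi => ?_
    exact (Polynomial.natDegree_C_mul_X_pow_le _ _).trans (Finset.mem_range.1 hi).le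
  obtain ⟨R, hR, hRd⟩ := Polynomial.exists_eq_pow_rootMultiplicity_mul_and_not_dvd Q hQ0 t0
  set m := Polynomial.rootMultiplicity t0 Q with hm
  have hR0 : R.eval t0 ≠ 0 := by
    intro h; exact hRd (Polynomial.dvd_iff_isRoot.2 h)
  have hRne : R ≠ 0 := by rintro rfl; simp at hR0
  have hdeg : d = m + R.natDegree := by
    have := congrArg Polynomial.natDegree hR
    rw [hQn, Polynomial.natDegree_mul (pow_ne_zero _ (Polynomial.X_sub_C_ne_zero t0)) hRne,
      Polynomial.natDegree_pow, Polynomial.natDegree_X_sub_C, mul_one] at this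
    exact this
  have hlt : m < d := by
    by_contra hcon
    have hmd : m = d := by omega
    have hRn : R.natDegree = 0 := by omega
    obtain ⟨r, hr⟩ := Polynomial.natDegree_eq_zero.1 hRn
    rw [← hr, hmd] at hR
    have hr0 : r ≠ 0 := by rintro rfl; simp at hr; exact hRne hr.symm
    have ht0 : t0 = 0 := by
      have h1 := hQc (d - 1) (by omega)
      rw [ha, hR, Polynomial.coeff_mul_C, sub_eq_add_neg, ← Polynomial.C_neg,
        Polynomial.coeff_X_add_C_pow] at h1
      have h2 : d - (d - 1) = 1 := by omega
      rw [h2, pow_one, ← Nat.choose_symm (by omega), h2, Nat.choose_one_right] at h1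
      have hdr : (d : ℝ) ≠ 0 := by exact_mod_cast hd
      rcases mul_eq_zero.1 h1 with h | h
      · rcases mul_eq_zero.1 h with h | h
        · linarith
        · exact absurd h hdr
      · exact absurd h hr0
    obtain ⟨i, hi, hai⟩ := hex
    apply hai
    rw [← hQc i hi, hR, ht0]
    simp [Polynomial.coeff_X_pow, hi.ne]
  refine ⟨m, hlt, fun τ => R.eval (t0 + τ), ?_, by simpa using hR0, ?_⟩
  · have h1 : AnalyticAt ℝ (fun x : ℝ => Polynomial.eval x R) (t0 + 0) :=
      AnalyticOnNhd.eval_polynomial R _ (Set.mem_univ _)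
    exact AnalyticAt.fun_comp (g := fun x : ℝ => Polynomial.eval x R)
      (f := fun τ : ℝ => t0 + τ) h1 (analyticAt_const.add analyticAt_id)
  · intro τ
    rw [← hQe, hR]; simp

lemma MU.tail {n : ℕ} {g : (Fin n → ℝ) → ℝ} (hg : MU g) : MU (fun z => g (Fin.tail z)) :=
  MU.comp (p := fun z : Fin (n + 1) → ℝ => Fin.tail z) (analyticAt_tail 0) rfl
    (fun i => MU.coord i.succ) hg

lemma mon_cons {n : ℕ} (β : Fin n → ℕ) (z : Fin (n + 1) → ℝ) :
    mon (Fin.cons 0 β : Fin (n + 1) → ℕ) z = mon β (Fin.tail z) := by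
  simp [mon, Fin.prod_univ_succ, Fin.tail]

lemma tendsto_cs {n : ℕ} {g : ι → ℝ} {h : ι → Fin n → ℝ} (hg : Tendsto g 𝓕 (𝓝 0))
    (hh : Tendsto h 𝓕 (𝓝 0)) : Tendsto (fun i => cs (g i) (h i)) 𝓕 (𝓝 0) := by
  rw [tendsto_pi_nhds] at hh ⊢
  intro k
  refine Fin.cases ?_ (fun k => ?_) k
  · simpa using hg
  · simpa using hh k

lemma mono_order {n : ℕ} (hM : Mono 𝓕 n) : ∀ (d : ℕ) (f : (Fin (n + 1) → ℝ) → ℝ) (v : ℝ → ℝ),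
    AnalyticAt ℝ f 0 → AnalyticAt ℝ v 0 → v 0 ≠ 0 →
    (∀ᶠ t in 𝓝 (0:ℝ), f (cs t 0) = t ^ d * v t) →
    ∀ X : ι → Fin (n + 1) → ℝ, Tendsto X 𝓕 (𝓝 0) →
      ∃ (p : (Fin (n + 1) → ℝ) → Fin (n + 1) → ℝ) (Y : ι → Fin (n + 1) → ℝ), Lift 𝓕 X p Y ∧
        MU (fun z => f (p z)) ∧ ∀ k : Fin n, MU (fun z => p z k.succ) := by
  intro d
  induction d using Nat.strong_induction_on with
  | _ d ih =>
  intro f v hf hv hv0 hfv X hX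
  rcases Nat.eq_zero_or_pos d with rfl | hdpos
  · refine ⟨_, X, Lift.id hX, MU.of_unit hf ?_, fun k => MU.coord k.succ⟩
    have := hfv.self_of_nhds
    rw [cs_zero_zero, pow_zero, one_mul] at this
    rwa [this]
  have hd : d ≠ 0 := hdpos.ne'
  obtain ⟨φ, c, U, hφ, hφ0, hc, hc0, hcd, hU, hU0, hE⟩ := tschirnhaus hf hd hv hv0 hfv
  have hφt : AnalyticAt ℝ (fun z : Fin (n + 1) → ℝ => φ (Fin.tail z)) 0 :=
    AnalyticAt.fun_comp (g := φ) hφ (analyticAt_tail 0)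
  have hX0 : Tendsto (fun i => X i 0) 𝓕 (𝓝 0) :=
    ((continuous_apply 0).tendsto (0 : Fin (n + 1) → ℝ)).comp hX
  have hXt : Tendsto (fun i => Fin.tail (X i)) 𝓕 (𝓝 0) :=
    ((analyticAt_tail 0).continuousAt.tendsto).comp hX
  have hXφ : Tendsto (fun i => φ (Fin.tail (X i))) 𝓕 (𝓝 0) := by
    have := hφt.continuousAt.tendsto.comp hX
    rwa [tail_zero', hφ0] at this
  have L1 : Lift 𝓕 X (fun z => cs (φ (Fin.tail z) + z 0) (Fin.tail z))
      (fun i => cs (X i 0 - φ (Fin.tail (X i))) (Fin.tail (X i))) := by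
    refine ⟨analyticAt_cs (hφt.add (analyticAt_coord 0 0)) (analyticAt_tail 0), ?_,
      tendsto_cs (by simpa using hX0.sub hXφ) hXt, ?_⟩
    · simp [hφ0]
    · simp
  by_cases hall : ∀ i < d, ∀ᶠ x in 𝓝 0, c i x = 0
  · refine ⟨_, _, L1, ?_, fun k => MU.coord k.succ⟩
    refine (((MU.coord 0).pow d).mul (MU.of_unit hU hU0)).congr ?_
    have htt : Tendsto (fun z : Fin (n + 1) → ℝ => Fin.tail z) (𝓝 0) (𝓝 0) :=
      (analyticAt_tail 0).continuousAt.tendsto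
    have : ∀ᶠ z in 𝓝 (0 : Fin (n + 1) → ℝ), ∀ i ∈ Finset.range d, c i (Fin.tail z) = 0 := by
      rw [Filter.eventually_all_finset]
      intro i hi
      exact htt.eventually (hall i (Finset.mem_range.1 hi))
    filter_upwards [hE, this] with z h1 h2
    rw [h1, Finset.sum_eq_zero, zero_add]
    intro i hi
    rw [h2 i hi, zero_mul]
  push Not at hall
  obtain ⟨P, W, β, c', LP, hPk, hβ, hc', hc'ex, hc'0⟩ := prep hM c hc hc0
    (by obtain ⟨i, hi, h⟩ := hall; exact ⟨i, hi, by simpa using h⟩) _ hXt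
  have hPan : AnalyticAt ℝ (fun z : Fin (n + 1) → ℝ => P (Fin.tail z)) 0 :=
    AnalyticAt.fun_comp (g := P) LP.an (analyticAt_tail 0)
  have hp2an : AnalyticAt ℝ (fun z : Fin (n + 1) → ℝ => cs (z 0) (P (Fin.tail z))) 0 :=
    analyticAt_cs (analyticAt_coord 0 0) hPan
  have L2 : Lift 𝓕 (fun i => cs (X i 0 - φ (Fin.tail (X i))) (Fin.tail (X i)))
      (fun z => cs (z 0) (P (Fin.tail z)))
      (fun i => cs (X i 0 - φ (Fin.tail (X i))) (W i)) := by
    refine ⟨hp2an, ?_, tendsto_cs (by simpa using hX0.sub hXφ) LP.tend, ?_⟩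
    · simp [LP.zero]
    · filter_upwards [LP.eq] with i hi
      simp [hi]
  set Y2 := (fun i => cs (X i 0 - φ (Fin.tail (X i))) (W i)) with hY2
  have L12 := L1.comp L2
  set β' : Fin (n + 1) → ℕ := Fin.cons 0 β with hβ'
  have hβ'0 : β' 0 = 0 := rfl
  have hE2 : ∀ᶠ z in 𝓝 (0 : Fin (n + 1) → ℝ),
      f (cs (φ (P (Fin.tail z)) + z 0) (P (Fin.tail z))) =
      ∑ i ∈ Finset.range d, mon β' z ^ (d - i) * c' i (Fin.tail z) * z 0 ^ i
        + z 0 ^ d * U (cs (z 0) (P (Fin.tail z))) := by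
    have htt : Tendsto (fun z : Fin (n + 1) → ℝ => Fin.tail z) (𝓝 0) (𝓝 0) :=
      (analyticAt_tail 0).continuousAt.tendsto
    have h1 : ∀ᶠ z in 𝓝 (0 : Fin (n + 1) → ℝ), ∀ i ∈ Finset.range d, c i (P (Fin.tail z)) =
        mon ((d - i) • β) (Fin.tail z) * c' i (Fin.tail z) := by
      rw [Filter.eventually_all_finset]
      intro i hi
      exact htt.eventually (hc' i (Finset.mem_range.1 hi)).2
    filter_upwards [L2.tendsto.eventually hE, h1] with z h2 h3
    simp only [tail_cs, cs_zero] at h2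
    rw [h2]
    congr 1
    refine Finset.sum_congr rfl fun i hi => ?_
    rw [h3 i hi, mon_nsmul, hβ', mon_cons]
  have hUp : AnalyticAt ℝ (fun z : Fin (n + 1) → ℝ => U (cs (z 0) (P (Fin.tail z)))) 0 :=
    AnalyticAt.fun_comp (g := U) (by rw [L2.zero]; exact hU) hp2an
  have hUp0 : U (cs ((0 : Fin (n + 1) → ℝ) 0) (P (Fin.tail (0 : Fin (n + 1) → ℝ)))) = U 0 :=
    congrArg U L2.zero
  have hc't : ∀ i < d, AnalyticAt ℝ (fun z : Fin (n + 1) → ℝ => c' i (Fin.tail z)) 0 :=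
    fun i hi => AnalyticAt.fun_comp (g := c' i) (hc' i hi).1 (analyticAt_tail 0)
  rcases dichotomy (𝓕 := 𝓕) (fun i => mon β' (Y2 i)) (fun i => Y2 i 0) with
    ⟨s, hs, hYs⟩ | ⟨t0, t, ht, hYt⟩
  · obtain ⟨p3, Y3, m, L3, hm, hm0, hmp, hMU3⟩ :=
      ratio_lemma 0 _ β' rfl hβ'0 Y2 s L2.tend hs hYs
    refine ⟨_, Y3, L12.comp L3, ?_, ?_⟩
    · have cmp : ∀ {g : (Fin (n + 1) → ℝ) → ℝ}, AnalyticAt ℝ g 0 →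
          AnalyticAt ℝ (fun z => g (p3 z)) 0 :=
        fun {g} hg => AnalyticAt.fun_comp (by rwa [L3.zero]) L3.an
      have hun : AnalyticAt ℝ (fun z => ∑ i ∈ Finset.range d, m z ^ (d - i) *
          c' i (Fin.tail (p3 z)) + U (cs (p3 z 0) (P (Fin.tail (p3 z))))) 0 := by
        refine (Finset.analyticAt_fun_sum _ fun i hi => ?_).add (cmp hUp)
        exact (hm.fun_pow _).mul (cmp (hc't i (Finset.mem_range.1 hi)))
      refine (((hMU3 0).pow d).mul (MU.of_unit hun ?_)).congr ?_
      · rw [L3.zero, hUp0, Finset.sum_eq_zero, zero_add]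
        · exact hU0
        · intro i hi
          have := Finset.mem_range.1 hi
          rw [hm0, zero_pow (by omega), zero_mul]
      · filter_upwards [L3.tendsto.eventually hE2, hmp] with z h1 h2
        simp only [tail_cs, cs_zero]
        rw [h1, mul_add, Finset.mul_sum]
        congr 1
        refine Finset.sum_congr rfl fun i hi => ?_
        have := Finset.mem_range.1 hi
        have e1 : p3 z 0 ^ d = p3 z 0 ^ (d - i) * p3 z 0 ^ i := by
          rw [← pow_add]; congr 1; omega
        rw [h2, mul_pow, e1]; ring
    · intro k
      simp only [cs_succ, tail_cs]
      exact MU.comp L3.an L3.zero hMU3 (g := fun z => P (Fin.tail z) k) (hPk k).tail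
  · let p3 : (Fin (n + 1) → ℝ) → Fin (n + 1) → ℝ :=
      fun z => Function.update z 0 (mon β' z * (t0 + z 0))
    have hp3an : AnalyticAt ℝ p3 0 := analyticAt_update
      ((analyticAt_mon β' 0).mul (analyticAt_const.add (analyticAt_coord 0 0))) 0
    have hp3t : ∀ z, Fin.tail (p3 z) = Fin.tail z := by
      intro z; ext k; simp [p3, Fin.tail]
    have hp3m : ∀ z, mon β' (p3 z) = mon β' z := fun z => mon_update hβ'0 z _
    have hp30 : ∀ z, p3 z 0 = mon β' z * (t0 + z 0) := fun z => by simp [p3]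
    have hβ'ne : β' ≠ 0 := by
      intro h
      apply hβ
      ext k
      have := congrFun h k.succ
      simpa [hβ'] using this
    have L3 : Lift 𝓕 Y2 p3 (fun i => Function.update (Y2 i) 0 (t i - t0)) := by
      refine ⟨hp3an, ?_, tendsto_update L2.tend (by simpa using ht.sub_const t0) 0, ?_⟩
      · simp [p3, mon_apply_zero hβ'ne]
      · filter_upwards [hYt] with i hi
        have e1 : mon β' (Function.update (Y2 i) 0 (t i - t0)) = mon β' (Y2 i) :=
          mon_update hβ'0 _ _
        simp only [p3]
        rw [e1]
        ext j
        refine Fin.cases ?_ (fun k => ?_) j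
        · simp [hi.2]
        · simp
    have cmp : ∀ {g : (Fin (n + 1) → ℝ) → ℝ}, AnalyticAt ℝ g 0 →
        AnalyticAt ℝ (fun z => g (p3 z)) 0 :=
      fun {g} hg => AnalyticAt.fun_comp (by rwa [L3.zero]) L3.an
    let g : (Fin (n + 1) → ℝ) → ℝ := fun z => ∑ i ∈ Finset.range d,
      c' i (Fin.tail z) * (t0 + z 0) ^ i + (t0 + z 0) ^ d * U (cs (p3 z 0) (P (Fin.tail (p3 z))))
    have hshift : AnalyticAt ℝ (fun z : Fin (n + 1) → ℝ => t0 + z 0) 0 :=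
      analyticAt_const.add (analyticAt_coord 0 0)
    have hg : AnalyticAt ℝ g 0 := by
      refine (Finset.analyticAt_fun_sum _ fun i hi => ?_).add ((hshift.fun_pow _).mul (cmp hUp))
      exact (hc't i (Finset.mem_range.1 hi)).mul (hshift.fun_pow _)
    obtain ⟨d', hd', v', hv', hv'0, hpoly⟩ := poly_order hd (fun i => c' i 0) hU0
      (by simp [hc'0 (d - 1) (by omega) hcd]) hc'ex t0
    have hgv : ∀ᶠ τ in 𝓝 (0:ℝ), g (cs τ 0) = τ ^ d' * v' τ := by
      refine Eventually.of_forall fun τ => ?_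
      rw [← hpoly]
      have e2 : p3 (cs τ 0) = 0 := by
        have : mon β' (cs τ 0) = 0 := by
          rw [hβ', mon_cons, tail_cs, mon_apply_zero hβ]
        simp only [p3, this, zero_mul]
        ext j
        refine Fin.cases ?_ (fun k => ?_) j <;> simp
      simp only [g, e2, hUp0, tail_cs, cs_zero]
    obtain ⟨p4, Y4, L4, hMU4, hk4⟩ := ih d' hd' g v' hg hv' hv'0 hgv _ L3.tend
    refine ⟨_, Y4, (L12.comp L3).comp L4, ?_, ?_⟩
    · have hmon4 : MU (fun z => mon β' (p4 z)) := by
        have := MU.mon_comp (p := fun z => Fin.tail (p4 z)) hk4 β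
        refine this.congr (Eventually.of_forall fun z => ?_)
        rw [hβ', mon_cons]
      refine ((hmon4.pow d).mul hMU4).congr ?_
      filter_upwards [(L3.comp L4).tendsto.eventually hE2] with z h1
      simp only [tail_cs, cs_zero]
      rw [h1]
      simp only [g]
      rw [mul_add, Finset.mul_sum]
      simp only [hp3m, hp3t, hp30]
      congr 1
      · refine Finset.sum_congr rfl fun i hi => ?_
        have := Finset.mem_range.1 hi
        have e1 : mon β' (p4 z) ^ d = mon β' (p4 z) ^ (d - i) * mon β' (p4 z) ^ i := by
          rw [← pow_add]; congr 1; omega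
        rw [e1, mul_pow]; ring
      · rw [mul_pow]; ring
    · intro k
      simp only [cs_succ, tail_cs, hp3t]
      refine MU.comp (p := fun z => Fin.tail (p4 z)) (g := fun z => P z k) ?_ ?_ hk4 (hPk k)
      · exact AnalyticAt.fun_comp (g := fun z : Fin (n + 1) → ℝ => Fin.tail z)
          (analyticAt_tail _) L4.an
      · rw [L4.zero]; rfl

end mono
end GF

namespace GF
open Topology

section loj

lemma exists_line {V : Type*} [NormedAddCommGroup V] [NormedSpace ℝ V] {F : V → ℝ}
    (hF : AnalyticAt ℝ F 0) (h : ¬ ∀ᶠ x in 𝓝 0, F x = 0) :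
    ∃ w : V, ¬ ∀ᶠ t in 𝓝 (0:ℝ), F (t • w) = 0 := by
  obtain ⟨r, hr, hball⟩ := hF.exists_ball_analyticOnNhd
  obtain ⟨w, hw, hFw⟩ : ∃ w ∈ Metric.ball (0:V) r, F w ≠ 0 := by
    by_contra hcon
    push Not at hcon
    exact h (eventually_of_mem (Metric.ball_mem_nhds 0 hr) hcon)
  refine ⟨w, fun hw0 => hFw ?_⟩
  have hmem : ∀ t ∈ Set.Icc (0:ℝ) 1, t • w ∈ Metric.ball (0:V) r := by
    intro t ht
    rw [mem_ball_zero_iff] at hw ⊢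
    rw [norm_smul, Real.norm_of_nonneg ht.1]
    exact lt_of_le_of_lt (mul_le_of_le_one_left (norm_nonneg _) ht.2) hw
  have han : AnalyticOnNhd ℝ (fun t : ℝ => F (t • w)) (Set.Icc 0 1) := by
    intro t ht
    exact AnalyticAt.fun_comp (g := F) (hball _ (hmem t ht)) (analyticAt_id.smul analyticAt_const)
  have := han.eqOn_zero_of_preconnected_of_eventuallyEq_zero isPreconnected_Icc
    (Set.left_mem_Icc.2 zero_le_one) hw0 (Set.right_mem_Icc.2 zero_le_one)
  simpa using this

lemma mono_all {ι : Type*} (𝓕 : Ultrafilter ι) (n : ℕ) : Mono 𝓕 n := by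
  induction n with
  | zero =>
    intro F hF hF0 X hX
    refine ⟨_, X, Lift.id hX, MU.of_unit hF fun h => hF0 (Eventually.of_forall fun x => ?_)⟩
    rwa [Subsingleton.elim x 0]
  | succ n ih =>
    intro F hF hF0 X hX
    by_cases h0 : F 0 = 0
    · obtain ⟨w, hw⟩ := exists_line hF hF0
      have hw0 : w ≠ 0 := by rintro rfl; exact hw (by simp [h0])
      have he : cs 1 (0 : Fin n → ℝ) ≠ 0 := fun h => by
        have := congrFun h 0
        simp at this
      obtain ⟨A, hA⟩ := SeparatingDual.exists_continuousLinearEquiv_apply_eq (R := ℝ) he hw0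
      have hcs : ∀ t : ℝ, A (cs t 0) = t • w := by
        intro t
        rw [← hA, ← map_smul]
        congr 1
        ext j
        refine Fin.cases ?_ (fun k => ?_) j <;> simp
      have hg : AnalyticAt ℝ (fun t : ℝ => F (t • w)) 0 :=
        AnalyticAt.fun_comp (g := F) (by simpa using hF) (analyticAt_id.smul analyticAt_const)
      obtain ⟨d, v, hv, hv0, hvE⟩ := hg.exists_eventuallyEq_pow_smul_nonzero_iff.2 hw
      have hfA : AnalyticAt ℝ (fun z => F (A z)) 0 :=
        AnalyticAt.fun_comp (g := F) (by simpa using hF)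
          ((A : (Fin (n + 1) → ℝ) →L[ℝ] (Fin (n + 1) → ℝ)).analyticAt 0)
      have hts : Tendsto (fun i => A.symm (X i)) 𝓕 (𝓝 0) := by
        have := (A.symm.continuous.tendsto 0).comp hX
        rw [map_zero] at this
        exact this
      obtain ⟨p, Y, hL, hMU, -⟩ := mono_order ih d (fun z => F (A z)) v hfA hv hv0 (by
        filter_upwards [hvE] with t ht
        rw [hcs, ht]; simp) (fun i => A.symm (X i)) hts
      have LA : Lift 𝓕 X (fun z => A z) (fun i => A.symm (X i)) :=
        ⟨(A : (Fin (n + 1) → ℝ) →L[ℝ] (Fin (n + 1) → ℝ)).analyticAt 0, by simp, hts, by simp⟩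
      exact ⟨_, Y, LA.comp hL, hMU⟩
    · exact ⟨_, X, Lift.id hX, MU.of_unit hF h0⟩

lemma fderiv_mon {κ : Type*} [Fintype κ] [DecidableEq κ] (α : κ → ℕ) (z : κ → ℝ) (k : κ) :
    z k * fderiv ℝ (mon α) z (Pi.single k 1) = α k * mon α z := by
  have h1 : HasFDerivAt (mon α) (fderiv ℝ (mon α) z)
      ((fun s : ℝ => z + s • (z k • (Pi.single k 1 : κ → ℝ))) 0) := by
    simpa using (analyticAt_mon α z).differentiableAt.hasFDerivAt
  have h2 : HasDerivAt (fun s : ℝ => z + s • (z k • (Pi.single k 1 : κ → ℝ)))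
      (z k • (Pi.single k 1 : κ → ℝ)) 0 := by
    have := ((hasDerivAt_id (0:ℝ)).smul_const (z k • (Pi.single k 1 : κ → ℝ))).const_add z
    simpa using this
  have h3 := h1.comp_hasDerivAt 0 h2
  have h4 : (mon α ∘ fun s : ℝ => z + s • (z k • (Pi.single k 1 : κ → ℝ))) =
      fun s => (1 + s) ^ α k * mon α z := by
    ext s
    simp only [Function.comp, mon]
    rw [← Finset.mul_prod_erase _ _ (Finset.mem_univ k),
      ← Finset.mul_prod_erase _ (fun i => z i ^ α i) (Finset.mem_univ k), ← mul_assoc, ← mul_pow]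
    congr 1
    · simp; ring
    · refine Finset.prod_congr rfl fun i hi => ?_
      simp [Finset.ne_of_mem_erase hi]
  rw [h4] at h3
  have h5 : HasDerivAt (fun s : ℝ => (1 + s) ^ α k * mon α z) (α k * mon α z) 0 := by
    have := (((hasDerivAt_id (0:ℝ)).const_add 1).pow (α k)).mul_const (mon α z)
    simpa using this
  have := h3.unique h5
  rw [map_smul, smul_eq_mul] at this
  exact this

lemma loj_monomial {κ : Type*} [Fintype κ] {α : κ → ℕ} (hα : α ≠ 0) {G : (κ → ℝ) → ℝ}
    (hG : MUe α G) : ∃ (N : ℕ) (c : ℝ), 0 < N ∧ 0 < c ∧ ∀ᶠ z in 𝓝 0, G z ≠ 0 →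
      c * |G z| ^ (1 - 1 / (N:ℝ)) ≤ ‖fderiv ℝ G z‖ := by
  classical
  obtain ⟨u, hu, hu0, hGu⟩ := hG
  obtain ⟨k0, hk0⟩ := Function.ne_iff.1 hα
  let N := ∑ i, α i
  have hN : 0 < N := Finset.sum_pos' (fun _ _ => Nat.zero_le _)
    ⟨k0, Finset.mem_univ _, Nat.pos_of_ne_zero hk0⟩
  let K := (2 / |u 0|) ^ (1 / (N:ℝ))
  have hu0' : 0 < |u 0| := abs_pos.2 hu0
  have hK : 0 < K := Real.rpow_pos_of_pos (by positivity) _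
  refine ⟨N, 1 / (4 * K), hN, by positivity, ?_⟩
  have hlim : ∀ k, α k ≠ 0 → ∀ᶠ z in 𝓝 (0 : κ → ℝ),
      |u 0| / 2 < |α k * u z + z k * fderiv ℝ u z (Pi.single k 1)| := by
    intro k hk
    have h1 : AnalyticAt ℝ (fun z : κ → ℝ => fderiv ℝ u z (Pi.single k 1)) 0 :=
      ((ContinuousLinearMap.apply ℝ ℝ (Pi.single k 1 : κ → ℝ)).analyticAt _).comp hu.fderiv
    have h2 := ((analyticAt_const (v := (α k : ℝ))).mul hu).add ((analyticAt_coord k 0).mul h1)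
    have h3 := h2.continuousAt.tendsto.abs
    refine h3.eventually_const_lt ?_
    simp only [Pi.add_apply, Pi.mul_apply, Pi.zero_apply, zero_mul, add_zero]
    rw [abs_mul, Nat.abs_cast]
    have : (1:ℝ) ≤ α k := by exact_mod_cast Nat.one_le_iff_ne_zero.2 hk
    nlinarith
  have hlim' : ∀ᶠ z in 𝓝 (0 : κ → ℝ), ∀ k, α k ≠ 0 →
      |u 0| / 2 < |α k * u z + z k * fderiv ℝ u z (Pi.single k 1)| := by
    rw [eventually_all]
    intro k
    by_cases hk : α k = 0
    · simp [hk]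
    · exact (hlim k hk).mono fun z hz _ => hz
  have hub : ∀ᶠ z in 𝓝 (0 : κ → ℝ), |u z| < 2 * |u 0| :=
    hu.continuousAt.tendsto.abs.eventually_lt_const (by linarith)
  have hlb : ∀ᶠ z in 𝓝 (0 : κ → ℝ), |u 0| / 2 < |u z| :=
    hu.continuousAt.tendsto.abs.eventually_const_lt (by linarith)
  filter_upwards [hlim', hub, hlb, eventually_eventually_nhds.2 hGu, hu.eventually_analyticAt]
    with z h1 h2 h3 h4 h5 hGz
  have hGz' := h4.self_of_nhds
  obtain ⟨k, hk, hkmin⟩ := Finset.exists_min_image (Finset.univ.filter fun k => α k ≠ 0)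
    (fun k => |z k|) ⟨k0, by simpa using hk0⟩
  have hkα : α k ≠ 0 := by simpa using hk
  have hmon0 : mon α z ≠ 0 := fun h => hGz (by rw [hGz', h, zero_mul])
  have hzk : z k ≠ 0 := by
    intro h
    apply hmon0
    exact Finset.prod_eq_zero (Finset.mem_univ k) (by rw [h, zero_pow hkα])
  have hzk' : 0 < |z k| := abs_pos.2 hzk
  have hmonlb : |z k| ^ N ≤ |mon α z| := by
    rw [mon, Finset.abs_prod, ← Finset.prod_pow_eq_pow_sum]
    refine Finset.prod_le_prod (fun _ _ => by positivity) fun i _ => ?_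
    rw [abs_pow]
    by_cases hi : α i = 0
    · simp [hi]
    · exact pow_le_pow_left₀ hzk'.le (hkmin i (by simpa using hi)) _
  have hfd : z k * fderiv ℝ G z (Pi.single k 1) =
      mon α z * (α k * u z + z k * fderiv ℝ u z (Pi.single k 1)) := by
    have e1 : fderiv ℝ G z = fderiv ℝ (fun x => mon α x * u x) z := Filter.EventuallyEq.fderiv_eq h4
    rw [e1, fderiv_fun_mul (analyticAt_mon α z).differentiableAt h5.differentiableAt]
    simp only [_root_.add_apply, _root_.smul_apply, smul_eq_mul]
    linear_combination u z * fderiv_mon α z k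
  have hg1 : |mon α z| * (|u 0| / 2) ≤ |z k| * ‖fderiv ℝ G z‖ := by
    calc |mon α z| * (|u 0| / 2) ≤ |mon α z| * |α k * u z + z k * fderiv ℝ u z (Pi.single k 1)| :=
          mul_le_mul_of_nonneg_left (h1 k hkα).le (abs_nonneg _)
      _ = |z k| * |fderiv ℝ G z (Pi.single k 1)| := by rw [← abs_mul, ← hfd, abs_mul]
      _ ≤ |z k| * ‖fderiv ℝ G z‖ := by
          refine mul_le_mul_of_nonneg_left ?_ hzk'.le
          have := (fderiv ℝ G z).le_opNorm (Pi.single k 1)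
          have hn : ‖(Pi.single k 1 : κ → ℝ)‖ ≤ 1 := by
            refine (pi_norm_le_iff_of_nonneg zero_le_one).2 fun i => ?_
            by_cases hik : i = k
            · subst hik; simp
            · simp [hik]
          exact this.trans (mul_le_of_le_one_right (norm_nonneg _) hn)
  have hGabs : |G z| = |mon α z| * |u z| := by rw [hGz', abs_mul]
  have hg2 : |G z| ≤ 4 * (|z k| * ‖fderiv ℝ G z‖) := by
    rw [hGabs]
    nlinarith [abs_pos.2 hmon0]
  have hg3 : |mon α z| ≤ 2 / |u 0| * |G z| := by
    rw [hGabs, div_mul_eq_mul_div, le_div_iff₀ hu0']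
    nlinarith [abs_pos.2 hmon0]
  have hGpos : 0 < |G z| := abs_pos.2 hGz
  have hN' : (N:ℝ) ≠ 0 := by exact_mod_cast hN.ne'
  have hzK : |z k| ≤ K * |G z| ^ (1 / (N:ℝ)) := by
    calc |z k| = (|z k| ^ N) ^ (1 / (N:ℝ)) := by
          rw [one_div, Real.pow_rpow_inv_natCast hzk'.le hN.ne']
      _ ≤ (2 / |u 0| * |G z|) ^ (1 / (N:ℝ)) :=
          Real.rpow_le_rpow (by positivity) (hmonlb.trans hg3) (by positivity)
      _ = K * |G z| ^ (1 / (N:ℝ)) := Real.mul_rpow (by positivity) (by positivity)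
  have hq : 0 < |G z| ^ (1 / (N:ℝ)) := Real.rpow_pos_of_pos hGpos _
  rw [Real.rpow_sub hGpos, Real.rpow_one]
  have hg4 : |G z| ≤ 4 * (K * |G z| ^ (1 / (N:ℝ)) * ‖fderiv ℝ G z‖) :=
    hg2.trans (by gcongr)
  rw [one_div_mul_eq_div, div_div, div_le_iff₀ (by positivity)]
  linarith

lemma lojasiewicz {n : ℕ} {F : (Fin n → ℝ) → ℝ} (hF : AnalyticAt ℝ F 0) (hF0 : F 0 = 0)
    (hne : ¬ ∀ᶠ x in 𝓝 0, F x = 0) :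
    ∃ θ C : ℝ, 0 < θ ∧ θ < 1 ∧ 0 < C ∧ ∀ᶠ x in 𝓝 0, |F x| ^ θ ≤ C * ‖fderiv ℝ F x‖ := by
  by_contra hcon
  push Not at hcon
  have hex : ∀ k : ℕ, ∃ x : Fin n → ℝ, ‖x‖ < 1 / ((k:ℝ) + 1) ∧
      ((k:ℝ) + 1) * ‖fderiv ℝ F x‖ < |F x| ^ (1 - 1 / ((k:ℝ) + 2)) := by
    intro k
    have hk : (0:ℝ) < 1 / ((k:ℝ) + 2) := by positivity
    have hk' : 1 / ((k:ℝ) + 2) < 1 := by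
      rw [div_lt_one (by positivity)]
      have : (0:ℝ) ≤ k := Nat.cast_nonneg k
      linarith
    have h1 := hcon (1 - 1 / ((k:ℝ) + 2)) ((k:ℝ) + 1) (by linarith) (by linarith) (by positivity)
    have h2 : ∀ᶠ x in 𝓝 (0 : Fin n → ℝ), ‖x‖ < 1 / ((k:ℝ) + 1) := by
      have : Tendsto (fun x : Fin n → ℝ => ‖x‖) (𝓝 0) (𝓝 0) := by
        simpa using (continuous_norm (E := Fin n → ℝ)).tendsto 0
      exact this.eventually_lt_const (by positivity)
    obtain ⟨x, hx1, hx2⟩ := (h1.and_eventually h2).exists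
    exact ⟨x, hx2, hx1⟩
  choose X hX1 hX2 using hex
  have hXt : Tendsto X atTop (𝓝 0) :=
    squeeze_zero_norm (fun k => (hX1 k).le) tendsto_one_div_add_atTop_nhds_zero_nat
  have hle : ((hyperfilter ℕ : Ultrafilter ℕ) : Filter ℕ) ≤ atTop := by
    rw [← Nat.cofinite_eq_atTop]; exact hyperfilter_le_cofinite
  obtain ⟨p, Y, hL, α, hMU⟩ := mono_all (hyperfilter ℕ) n F hF hne X (hXt.mono_left hle)
  have hα : α ≠ 0 := by
    intro h
    obtain ⟨u, hu, hu0, hgu⟩ := hMU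
    have := hgu.self_of_nhds
    rw [h, mon_zero, one_mul] at this
    beta_reduce at this
    rw [hL.zero, hF0] at this
    exact hu0 this.symm
  obtain ⟨N, c, hN, hc, hloj⟩ := loj_monomial hα hMU
  let M := ‖fderiv ℝ p 0‖ + 1
  have hM : 0 < M := by positivity
  have hpM : ∀ᶠ z in 𝓝 (0 : Fin n → ℝ), ‖fderiv ℝ p z‖ < M :=
    hL.an.fderiv.continuousAt.tendsto.norm.eventually_lt_const (by simp [M])
  have hFsmall : ∀ᶠ x in 𝓝 (0 : Fin n → ℝ), |F x| < 1 := by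
    refine hF.continuousAt.tendsto.abs.eventually_lt_const ?_
    simp [hF0]
  obtain ⟨k1, hk1⟩ := exists_nat_gt (M / c)
  have hev : ∀ᶠ k in ((hyperfilter ℕ : Ultrafilter ℕ) : Filter ℕ), N ≤ k + 2 ∧ k1 ≤ k :=
    hle ((eventually_ge_atTop (max N k1)).mono fun k hk => by omega)
  obtain ⟨k, hk2, hk3, hk4, hk5, hk6, hk7, hk8⟩ := (hev.and ((hL.tend.eventually hloj).and
    ((hL.tend.eventually hpM).and ((hL.tend.eventually hL.an.eventually_analyticAt).and
    (((hXt.mono_left hle).eventually hFsmall).and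
    (((hXt.mono_left hle).eventually hF.eventually_analyticAt).and hL.eq)))))).exists
  have hX2k := hX2 k
  have hkk : (0:ℝ) ≤ k := Nat.cast_nonneg k
  have hFne : F (X k) ≠ 0 := by
    intro h
    have h1 : 1 / ((k:ℝ) + 2) < 1 := by rw [div_lt_one (by positivity)]; linarith
    rw [h, abs_zero, Real.zero_rpow (by linarith)] at hX2k
    have : 0 ≤ ((k:ℝ) + 1) * ‖fderiv ℝ F (X k)‖ := by positivity
    linarith
  have hFpos : 0 < |F (X k)| := abs_pos.2 hFne
  have hchain : ‖fderiv ℝ (fun z => F (p z)) (Y k)‖ ≤ ‖fderiv ℝ F (X k)‖ * M := by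
    have e1 : fderiv ℝ (fun z => F (p z)) (Y k) =
        (fderiv ℝ F (p (Y k))).comp (fderiv ℝ p (Y k)) :=
      fderiv_comp (Y k) (by rw [hk8]; exact hk7.differentiableAt) hk5.differentiableAt
    rw [e1, hk8]
    refine (ContinuousLinearMap.opNorm_comp_le _ _).trans ?_
    exact mul_le_mul_of_nonneg_left hk4.le (norm_nonneg _)
  have hlow := (hk3 (by beta_reduce; rwa [hk8])).trans hchain
  beta_reduce at hlow
  rw [hk8] at hlow
  have hexp : |F (X k)| ^ (1 - 1 / ((k:ℝ) + 2)) ≤ |F (X k)| ^ (1 - 1 / (N:ℝ)) := by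
    refine Real.rpow_le_rpow_of_exponent_ge hFpos hk6.le ?_
    have : 1 / ((k:ℝ) + 2) ≤ 1 / (N:ℝ) := by
      refine one_div_le_one_div_of_le (by exact_mod_cast hN) ?_
      exact_mod_cast hk2.1
    linarith
  set A := |F (X k)| ^ (1 - 1 / (N:ℝ)) with hA
  have hApos : 0 < A := Real.rpow_pos_of_pos hFpos _
  have h9 : ((k:ℝ) + 1) * ‖fderiv ℝ F (X k)‖ < A := hX2k.trans_le hexp
  have h10 : M < c * ((k:ℝ) + 1) := by
    have : (k1:ℝ) ≤ k := by exact_mod_cast hk2.2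
    rw [div_lt_iff₀ hc] at hk1
    nlinarith
  have h11 : ((k:ℝ) + 1) * (c * A) ≤ ((k:ℝ) + 1) * (‖fderiv ℝ F (X k)‖ * M) :=
    mul_le_mul_of_nonneg_left hlow (by positivity)
  have h12 : ((k:ℝ) + 1) * ‖fderiv ℝ F (X k)‖ * M < A * M := mul_lt_mul_of_pos_right h9 hM
  have h13 : M * A < c * ((k:ℝ) + 1) * A := mul_lt_mul_of_pos_right h10 hApos
  linarith

end loj
end GF

namespace GF
open Topology

lemma global_flow {E : Type*} [NormedAddCommGroup E] [NormedSpace ℝ E] [CompleteSpace E]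
    {v : E → E} {K : NNReal} (hv : LipschitzWith K v) {M : ℝ} (hM : ∀ x, ‖v x‖ ≤ M) (x0 : E) :
    ∃ γ : ℝ → E, γ 0 = x0 ∧ ∀ t, HasDerivAt γ (v (γ t)) t := by
  have hM0 : 0 ≤ M := (norm_nonneg _).trans (hM x0)
  lift M to NNReal using hM0
  have h1 : ∀ N : ℕ, ∃ α : ℝ → E, α 0 = x0 ∧ ∀ t ∈ Set.Ioo (-(N:ℝ)-1) (N+1),
      HasDerivAt α (v (α t)) t := by
    intro N
    have hN : (0:ℝ) ≤ N := Nat.cast_nonneg N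
    have hp : IsPicardLindelof (fun _ ↦ v) (tmin := -(N:ℝ)-1) (tmax := N+1)
        ⟨0, by constructor <;> linarith⟩ x0 (M * (N+1)) 0 M K := by
      refine IsPicardLindelof.of_time_independent (fun x _ => hM x) hv.lipschitzOnWith ?_
      have e1 : (N:ℝ) + 1 - 0 = N + 1 := by ring
      have e2 : 0 - (-(N:ℝ) - 1) = N + 1 := by ring
      simp only [e1, e2, max_self]
      push_cast
      simp
    obtain ⟨α, h0, hα⟩ := hp.exists_eq_forall_mem_Icc_hasDerivWithinAt₀
    refine ⟨α, h0, fun t ht => ?_⟩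
    exact (hα t ⟨ht.1.le, ht.2.le⟩).hasDerivAt (Icc_mem_nhds ht.1 ht.2)
  choose α h0 hα using h1
  have huniq : ∀ N N' : ℕ, N ≤ N' → Set.EqOn (α N) (α N') (Set.Ioo (-(N:ℝ)-1) (N+1)) := by
    intro N N' h
    have h' : (N:ℝ) ≤ N' := by exact_mod_cast h
    have hN : (0:ℝ) ≤ N := Nat.cast_nonneg N
    refine ODE_solution_unique_of_mem_Ioo (v := fun _ => v) (s := fun _ => Set.univ) (K := K)
      (t₀ := 0) (fun _ _ => hv.lipschitzOnWith) (by constructor <;> linarith)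
      (fun t ht => ⟨hα N t ht, trivial⟩)
      (fun t ht => ⟨hα N' t ⟨by linarith [ht.1], by linarith [ht.2]⟩, trivial⟩) ?_
    rw [h0, h0]
  have key : ∀ N : ℕ, ∀ t ∈ Set.Ioo (-(N:ℝ)-1) (N+1), α ⌈|t|⌉₊ t = α N t := by
    intro N t ht
    have ht2 : t ∈ Set.Ioo (-((⌈|t|⌉₊:ℕ):ℝ)-1) ((⌈|t|⌉₊:ℕ)+1) := by
      have := abs_le.1 (Nat.le_ceil |t|)
      constructor <;> linarith [this.1, this.2]
    rcases le_total N ⌈|t|⌉₊ with h | h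
    · exact (huniq _ _ h ht).symm
    · exact huniq _ _ h ht2
  refine ⟨fun t => α ⌈|t|⌉₊ t, ?_, ?_⟩
  · simp [h0]
  · intro t
    have ht2 : t ∈ Set.Ioo (-((⌈|t|⌉₊:ℕ):ℝ)-1) ((⌈|t|⌉₊:ℕ)+1) := by
      have := abs_le.1 (Nat.le_ceil |t|)
      constructor <;> linarith [this.1, this.2]
    refine (hα _ t ht2).congr_of_eventuallyEq ?_
    filter_upwards [isOpen_Ioo.mem_nhds ht2] with s hs
    exact key _ s hs

lemma loj_euclid {n : ℕ} {f : EuclideanSpace ℝ (Fin n) → ℝ} (p : EuclideanSpace ℝ (Fin n))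
    (hf : ∀ x, AnalyticAt ℝ f x) (hp : f p = 0) (hne : ¬ ∀ᶠ x in 𝓝 p, f x = 0) :
    ∃ θ C : ℝ, 0 < θ ∧ θ < 1 ∧ 0 < C ∧ ∀ᶠ y in 𝓝 p, |f y| ^ θ ≤ C * ‖gradient f y‖ := by
  set L := EuclideanSpace.equiv (Fin n) ℝ with hL
  set F : (Fin n → ℝ) → ℝ := fun x => f (p + L.symm x) with hFdef
  have hF : AnalyticAt ℝ F 0 := by
    have h1 : AnalyticAt ℝ (fun x => p + L.symm x) 0 :=
      analyticAt_const.add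
        ((L.symm : (Fin n → ℝ) →L[ℝ] EuclideanSpace ℝ (Fin n)).analyticAt 0)
    exact (hf _).comp h1
  have hF0 : F 0 = 0 := by simp [hFdef, hp]
  have ht : Tendsto (fun y => L (y - p)) (𝓝 p) (𝓝 0) := by
    have : Continuous (fun y => L (y - p)) := by fun_prop
    simpa using this.tendsto p
  have hne' : ¬ ∀ᶠ x in 𝓝 0, F x = 0 := by
    intro h
    apply hne
    filter_upwards [ht.eventually h] with y hy
    simpa [hFdef] using hy
  obtain ⟨θ, C, h1, h2, h3, h4⟩ := lojasiewicz hF hF0 hne'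
  set m := ‖(L.symm : (Fin n → ℝ) →L[ℝ] EuclideanSpace ℝ (Fin n))‖ with hm
  refine ⟨θ, C * (m + 1), h1, h2, by positivity, ?_⟩
  filter_upwards [ht.eventually h4] with y hy
  have hd : fderiv ℝ F (L (y - p)) =
      (fderiv ℝ f y).comp (L.symm : (Fin n → ℝ) →L[ℝ] EuclideanSpace ℝ (Fin n)) := by
    have e : p + L.symm (L (y - p)) = y := by simp
    have h5 : HasFDerivAt f (fderiv ℝ f y) (p + L.symm (L (y - p))) := by
      rw [e]; exact (hf y).differentiableAt.hasFDerivAt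
    have h6 : HasFDerivAt (fun x => p + L.symm x)
        (L.symm : (Fin n → ℝ) →L[ℝ] EuclideanSpace ℝ (Fin n)) (L (y - p)) :=
      ((L.symm : (Fin n → ℝ) →L[ℝ] EuclideanSpace ℝ (Fin n)).hasFDerivAt).const_add p
    exact (HasFDerivAt.comp (f := fun x => p + L.symm x) (L (y - p)) h5 h6).fderiv
  have hg : ‖gradient f y‖ = ‖fderiv ℝ f y‖ := by
    simp [gradient]
  have hFy : F (L (y - p)) = f y := by simp [hFdef]
  rw [hd, hFy] at hy
  rw [hg]
  calc _ ≤ _ := hy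
    _ ≤ C * (‖fderiv ℝ f y‖ * m) := by
      gcongr; exact ContinuousLinearMap.opNorm_comp_le _ _
    _ ≤ C * (m+1) * ‖fderiv ℝ f y‖ := by
      nlinarith [mul_nonneg h3.le (norm_nonneg (fderiv ℝ f y))]

lemma cut_field {n : ℕ} {f : EuclideanSpace ℝ (Fin n) → ℝ} (p : EuclideanSpace ℝ (Fin n))
    (hf : ∀ x, AnalyticAt ℝ f x) {r : ℝ} (hr : 0 < r) :
    ∃ χ : EuclideanSpace ℝ (Fin n) → ℝ, (∀ x ∈ Metric.closedBall p r, χ x = 1) ∧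
      (∀ x, 0 ≤ χ x) ∧
      (∃ K, LipschitzWith K (fun x => -(χ x • gradient f x))) ∧
      ∃ M : ℝ, ∀ x, ‖-(χ x • gradient f x)‖ ≤ M := by
  let χ : ContDiffBump p := ⟨r, 2*r, hr, by linarith⟩
  have hg : ContDiff ℝ 1 (gradient f) := by
    have h1 : ContDiff ℝ 1 (fderiv ℝ f) := by
      have : ContDiff ℝ 2 f := contDiff_iff_contDiffAt.2 fun x => (hf x).contDiffAt
      exact this.fderiv_right (by norm_num)
    exact (InnerProductSpace.toDual ℝ (EuclideanSpace ℝ (Fin n))).symm.contDiff.comp h1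
  have hs : HasCompactSupport (fun x => -(χ x • gradient f x)) := by
    have := (χ.hasCompactSupport.smul_right (f' := gradient f)).neg
    exact this
  have hc : ContDiff ℝ 1 (fun x => -(χ x • gradient f x)) := (χ.contDiff.smul hg).neg
  exact ⟨χ, fun x hx => χ.one_of_mem_closedBall hx, fun x => χ.nonneg,
    ContDiff.lipschitzWith_of_hasCompactSupport hs hc (by simp),
    hs.exists_bound_of_continuous hc.continuous⟩

end GF

namespace GF
open Topology

lemma flow_core {E : Type*} [NormedAddCommGroup E] [InnerProductSpace ℝ E] [CompleteSpace E]
    {f χ : E → ℝ} (hf : Differentiable ℝ f) (hg : Continuous (gradient f)) {p : E} {r θ C : ℝ}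
    (hθ : 0 < θ) (hθ1 : θ < 1) (hC : 0 < C)
    (hloj : ∀ y ∈ Metric.closedBall p r, |f y| ^ θ ≤ C * ‖gradient f y‖)
    (hχ : ∀ x ∈ Metric.closedBall p r, χ x = 1)
    {γ : ℝ → E} (hγ : ∀ t, HasDerivAt γ (-(χ (γ t) • gradient f (γ t))) t)
    (hpos : ∀ t, 0 < f (γ t))
    (h0 : dist (γ 0) p + C * (f (γ 0) ^ (1 - θ) / (1 - θ)) < r) :
    (∀ t, 0 ≤ t → γ t ∈ Metric.closedBall p r) ∧
      ∃ q ∈ Metric.closedBall p r, f q = 0 ∧ Tendsto γ atTop (𝓝 q) := by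
  have hγc : Continuous γ := continuous_iff_continuousAt.2 fun t => (hγ t).continuousAt
  have hgd : ∀ t, γ t ∈ Metric.closedBall p r →
      HasDerivAt (fun t => f (γ t)) (-‖gradient f (γ t)‖ ^ 2) t := by
    intro t ht
    have h1 := (hf (γ t)).hasGradientAt.hasFDerivAt.comp_hasDerivAt t (hγ t)
    rw [hχ _ ht] at h1
    have h2 : (InnerProductSpace.toDual ℝ E (gradient f (γ t)))
        (-((1:ℝ) • gradient f (γ t))) = -‖gradient f (γ t)‖ ^ 2 := by
      rw [InnerProductSpace.toDual_apply_apply, one_smul, inner_neg_right,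
        real_inner_self_eq_norm_sq]
    rw [h2] at h1
    exact h1
  have h1θ : 0 < 1 - θ := by linarith
  set w : ℝ → ℝ := fun t => f (γ t) ^ (1 - θ) / (1 - θ) with hw
  have hwpos : ∀ t, 0 ≤ w t := fun t => div_nonneg (Real.rpow_nonneg (hpos t).le _) h1θ.le
  have hwd : ∀ t, γ t ∈ Metric.closedBall p r →
      HasDerivAt w (-(‖gradient f (γ t)‖ ^ 2 * f (γ t) ^ (-θ))) t := by
    intro t ht
    have h1 := ((hgd t ht).rpow_const (p := 1 - θ) (Or.inl (hpos t).ne')).div_const (1 - θ)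
    have h2 : -‖gradient f (γ t)‖ ^ 2 * (1 - θ) * f (γ t) ^ (1 - θ - 1) / (1 - θ) =
        -(‖gradient f (γ t)‖ ^ 2 * f (γ t) ^ (-θ)) := by
      rw [show 1 - θ - 1 = -θ by ring]
      field_simp
    rw [h2] at h1
    exact h1
  have hwc : Continuous w := by
    refine Continuous.div_const ?_ _
    exact (hf.continuous.comp hγc).rpow_const (fun t => Or.inl (hpos t).ne')
  have hbd : ∀ t, γ t ∈ Metric.closedBall p r →
      ‖gradient f (γ t)‖ ≤ C * (‖gradient f (γ t)‖ ^ 2 * f (γ t) ^ (-θ)) := by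
    intro t ht
    have h1 := hloj _ ht
    rw [abs_of_pos (hpos t)] at h1
    have h2 : f (γ t) ^ θ * f (γ t) ^ (-θ) = 1 := by
      rw [← Real.rpow_add (hpos t)]; simp
    have h3 : 0 ≤ f (γ t) ^ (-θ) := Real.rpow_nonneg (hpos t).le _
    calc ‖gradient f (γ t)‖ = ‖gradient f (γ t)‖ * (f (γ t) ^ θ * f (γ t) ^ (-θ)) := by
          rw [h2, mul_one]
      _ ≤ ‖gradient f (γ t)‖ * ((C * ‖gradient f (γ t)‖) * f (γ t) ^ (-θ)) := by gcongr
      _ = _ := by ring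
  have hstep : ∀ s t, s ≤ t → (∀ x ∈ Set.Ico s t, γ x ∈ Metric.closedBall p r) →
      ‖γ t - γ s‖ ≤ C * (w s - w t) := by
    intro s t hst hx
    refine image_norm_le_of_norm_deriv_right_le_deriv_boundary' (a := s) (b := t)
      (f := fun x => γ x - γ s) (f' := fun x => -(χ (γ x) • gradient f (γ x)))
      (B := fun x => C * (w s - w x))
      (B' := fun x => C * (‖gradient f (γ x)‖ ^ 2 * f (γ x) ^ (-θ)))
      (by fun_prop) ?_ (by simp) (by fun_prop) ?_ ?_ ⟨hst, le_rfl⟩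
    · intro x _
      exact ((hγ x).sub_const _).hasDerivWithinAt
    · intro x hx'
      have := ((hwd x (hx x hx')).const_sub (w s)).const_mul C
      rw [neg_neg] at this
      exact this.hasDerivWithinAt
    · intro x hx'
      rw [hχ _ (hx x hx'), one_smul, norm_neg]
      exact hbd x (hx x hx')
  have hstay : ∀ t, 0 ≤ t → γ t ∈ Metric.ball p r := by
    by_contra! hcon
    obtain ⟨t0, ht0, ht0'⟩ := hcon
    set S : Set ℝ := {t | 0 ≤ t ∧ γ t ∉ Metric.ball p r} with hS
    have hSc : IsClosed S := by
      have : S = Set.Ici 0 ∩ γ ⁻¹' (Metric.ball p r)ᶜ := by ext; simp [hS]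
      rw [this]
      exact isClosed_Ici.inter (Metric.isOpen_ball.isClosed_compl.preimage hγc)
    have hbdd : BddBelow S := ⟨0, fun t ht => ht.1⟩
    have hT := hSc.csInf_mem ⟨t0, ht0, ht0'⟩ hbdd
    set T := sInf S
    have h2 := hstep 0 T hT.1 (fun x hx => by
      by_contra hc
      have : x ∈ S := ⟨hx.1, fun h => hc (Metric.ball_subset_closedBall h)⟩
      exact absurd (csInf_le hbdd this) (not_le.2 hx.2))
    apply hT.2
    rw [Metric.mem_ball]
    calc dist (γ T) p ≤ dist (γ T) (γ 0) + dist (γ 0) p := dist_triangle _ _ _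
      _ ≤ C * w 0 + dist (γ 0) p := by
          rw [dist_eq_norm (γ T)]
          have := mul_nonneg hC.le (hwpos T)
          linarith
      _ < r := by linarith
  have hstay' : ∀ t, 0 ≤ t → γ t ∈ Metric.closedBall p r :=
    fun t ht => Metric.ball_subset_closedBall (hstay t ht)
  refine ⟨hstay', ?_⟩
  have hst2 : ∀ s t, 0 ≤ s → s ≤ t → ‖γ t - γ s‖ ≤ C * (w s - w t) := fun s t hs hst =>
    hstep s t hst (fun x hx => hstay' x (hs.trans hx.1))
  have hanti : Antitone (fun t => w (max t 0)) := by
    intro s t hst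
    have h1 := (norm_nonneg _).trans
      (hst2 (max s 0) (max t 0) (le_max_right _ _) (max_le_max_right 0 hst))
    have := (mul_nonneg_iff_of_pos_left hC).1 h1
    simp only
    linarith
  have hbb : BddBelow (Set.range (fun t => w (max t 0))) :=
    ⟨0, by rintro _ ⟨t, rfl⟩; exact hwpos _⟩
  have hlim := tendsto_atTop_ciInf hanti hbb
  set l := ⨅ t, w (max t 0)
  have hcau : CauchySeq (fun t => γ (max t 0)) := by
    refine cauchySeq_of_le_tendsto_0 (fun t => C * (w (max t 0) - l) * 2) ?_ ?_
    · intro a b N ha hb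
      have hN : ∀ a, N ≤ a → dist (γ (max a 0)) (γ (max N 0)) ≤ C * (w (max N 0) - l) := by
        intro a ha
        rw [dist_eq_norm]
        refine (hst2 _ _ (le_max_right _ _) (max_le_max_right 0 ha)).trans ?_
        have : l ≤ w (max a 0) := ciInf_le hbb a
        gcongr
      have := dist_triangle_right (γ (max a 0)) (γ (max b 0)) (γ (max N 0))
      linarith [hN a ha, hN b hb]
    · have := ((hlim.sub_const l).const_mul C).mul_const 2
      simpa using this
  obtain ⟨q, hq⟩ := cauchySeq_tendsto_of_complete hcau
  have hq' : Tendsto γ atTop (𝓝 q) := by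
    refine hq.congr' ?_
    filter_upwards [eventually_ge_atTop 0] with t ht
    rw [max_eq_left ht]
  have hqb : q ∈ Metric.closedBall p r :=
    Metric.isClosed_closedBall.mem_of_tendsto hq
      (Eventually.of_forall fun t => hstay' _ (le_max_right _ _))
  refine ⟨q, hqb, ?_, hq'⟩
  by_contra hfq
  have hgq : 0 < ‖gradient f q‖ := by
    have h1 := hloj q hqb
    have h2 : 0 < |f q| ^ θ := Real.rpow_pos_of_pos (abs_pos.2 hfq) _
    exact pos_of_mul_pos_right (h2.trans_le h1) hC.le
  set δ := ‖gradient f q‖ ^ 2 / 2 with hδ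
  have hδ0 : 0 < δ := by positivity
  have hev : ∀ᶠ t in atTop, δ < ‖gradient f (γ t)‖ ^ 2 := by
    have : Tendsto (fun t => ‖gradient f (γ t)‖ ^ 2) atTop (𝓝 (‖gradient f q‖ ^ 2)) :=
      (((hg.tendsto q).comp hq').norm).pow 2
    exact this.eventually (lt_mem_nhds (by rw [hδ]; linarith [pow_pos hgq 2]))
  obtain ⟨T, hT⟩ := eventually_atTop.1 (hev.and (eventually_ge_atTop 0))
  have hA : AntitoneOn (fun t => f (γ t) + δ * t) (Set.Ici T) := by
    have hd : ∀ t ∈ Set.Ici T,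
        HasDerivAt (fun t => f (γ t) + δ * t) (-‖gradient f (γ t)‖ ^ 2 + δ * 1) t := fun t ht =>
      (hgd t (hstay' t (hT t ht).2)).add ((hasDerivAt_id t).const_mul δ)
    refine antitoneOn_of_deriv_nonpos (convex_Ici T)
      (fun t ht => (hd t ht).continuousAt.continuousWithinAt) ?_ ?_
    · intro t ht
      exact (hd t (interior_subset ht)).differentiableAt.differentiableWithinAt
    · intro t ht
      rw [(hd t (interior_subset ht)).deriv]
      linarith [(hT t (interior_subset ht)).1]
  have hT1 : T ≤ T + f (γ T) / δ := by
    have := div_nonneg (hpos T).le hδ0.le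
    linarith
  have h3 := hA (Set.mem_Ici.2 le_rfl) (Set.mem_Ici.2 hT1) hT1
  simp only [mul_add, mul_div_cancel₀ _ hδ0.ne'] at h3
  have h4 : δ * (f (γ T) / δ) = f (γ T) := by field_simp
  have := hpos (T + f (γ T) / δ)
  linarith

end GF

/-- For a nonnegative analytic `f` whose zero set is nonempty with empty
interior, the points of `f⁻¹(0)` that are limits of nonconstant gradient flows are
dense in `f⁻¹(0)`. -/
theorem limits_of_gradient_flows_dense_in_zero_set
    (n : ℕ)
    (f : EuclideanSpace ℝ (Fin n) → ℝ)
    (hf : ∀ x, AnalyticAt ℝ f x)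
    (hnonneg : ∀ x, 0 ≤ f x)
    (hne : (f ⁻¹' {0}).Nonempty)
    (hint : interior (f ⁻¹' {0}) = ∅) :
    f ⁻¹' {0} ⊆
      closure {q ∈ f ⁻¹' {0} |
        ∃ γ : ℝ → EuclideanSpace ℝ (Fin n),
          (∀ t : ℝ, 0 ≤ t → HasDerivAt γ (-(gradient f (γ t))) t) ∧
          (∃ t₁ t₂ : ℝ, 0 ≤ t₁ ∧ 0 ≤ t₂ ∧ γ t₁ ≠ γ t₂) ∧
          Tendsto γ atTop (nhds q)} := by
  intro p hp
  have hp0 : f p = 0 := hp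
  have hnz : ¬ ∀ᶠ x in nhds p, f x = 0 := by
    intro h
    have : p ∈ interior (f ⁻¹' {0}) := mem_interior_iff_mem_nhds.2 h
    rw [hint] at this
    exact this
  have hdiff : Differentiable ℝ f := fun x => (hf x).differentiableAt
  have hgc : Continuous (gradient f) := by
    have h2 : ContDiff ℝ 1 f := contDiff_iff_contDiffAt.2 fun x => (hf x).contDiffAt
    exact (InnerProductSpace.toDual ℝ (EuclideanSpace ℝ (Fin n))).symm.continuous.comp
      (h2.continuous_fderiv (by simp))
  obtain ⟨θ, C, hθ, hθ1, hC, hloj⟩ := GF.loj_euclid p hf hp0 hnz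
  rw [Metric.mem_closure_iff]
  intro ε hε
  obtain ⟨R, hR, hRb⟩ := Metric.eventually_nhds_iff_ball.1 hloj
  set r := min (R / 2) (ε / 2) with hr
  have hr0 : 0 < r := lt_min (by linarith) (by linarith)
  have hrR : r < R := (min_le_left _ _).trans_lt (by linarith)
  have hrε : r < ε := (min_le_right _ _).trans_lt (by linarith)
  obtain ⟨χ, hχ1, hχ0, ⟨K, hK⟩, M, hM⟩ := GF.cut_field p hf hr0
  have h1θ : 0 < 1 - θ := by linarith
  obtain ⟨x0, hx0, hx0'⟩ : ∃ x0, f x0 ≠ 0 ∧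
      dist x0 p + C * (f x0 ^ (1 - θ) / (1 - θ)) < r := by
    have hcont : Tendsto (fun x => dist x p + C * (f x ^ (1 - θ) / (1 - θ))) (nhds p) (nhds 0) := by
      have : Continuous (fun x => dist x p + C * (f x ^ (1 - θ) / (1 - θ))) := by
        have h5 : Continuous (fun x => f x ^ (1 - θ)) :=
          hdiff.continuous.rpow_const (fun x => Or.inr h1θ.le)
        fun_prop
      simpa [hp0, Real.zero_rpow h1θ.ne'] using this.tendsto p
    have h6 : ∃ᶠ x in nhds p, f x ≠ 0 := not_eventually.1 hnz
    exact (h6.and_eventually (hcont.eventually (gt_mem_nhds hr0))).exists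
  obtain ⟨γ, hγ0, hγ⟩ := GF.global_flow hK hM x0
  have hpos : ∀ t, 0 < f (γ t) := by
    intro t
    refine lt_of_le_of_ne (hnonneg _) (fun h => hx0 ?_)
    have hmin : IsLocalMin f (γ t) := Eventually.of_forall fun x => by
      rw [← h]; exact hnonneg x
    have hgz : gradient f (γ t) = 0 := by simp [gradient, hmin.fderiv_eq_zero]
    have : γ = fun _ => γ t := by
      refine ODE_solution_unique_univ (v := fun _ x => -(χ x • gradient f x))
        (s := fun _ => Set.univ) (K := K) (t₀ := t) (fun _ => hK.lipschitzOnWith)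
        (fun s => ⟨hγ s, trivial⟩) (fun s => ⟨?_, trivial⟩) rfl
      simp only [hgz, smul_zero, neg_zero]
      exact hasDerivAt_const _ _
    have h7 := congrFun this 0
    rw [← hγ0, h7, ← h]
  obtain ⟨hstay, q, hqb, hfq, hq⟩ := GF.flow_core hdiff hgc hθ hθ1 hC
    (fun y hy => hRb y (Metric.closedBall_subset_ball hrR hy)) hχ1 hγ hpos (by rw [hγ0]; exact hx0')
  refine ⟨q, ⟨hfq, γ, ?_, ?_, hq⟩, ?_⟩
  · intro t ht
    have := hγ t
    rwa [hχ1 _ (hstay t ht), one_smul] at this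
  · by_contra! hcon
    have h8 : Tendsto γ atTop (nhds x0) := by
      refine tendsto_const_nhds.congr' ?_
      filter_upwards [eventually_ge_atTop 0] with t ht
      rw [← hγ0]
      exact hcon 0 t le_rfl ht
    exact hx0 (by rw [tendsto_nhds_unique h8 hq]; exact hfq)
  · rw [dist_comm]
    exact (Metric.mem_closedBall.1 hqb).trans_lt hrε
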